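/- arXiv:1812.08346 — 2 statements merged into one kernel-verified Lean document; each statement's English description precedes it below -/
import Mathlib

section
/- Let K be an algebraically closed field of characteristic zero and (X, s) an algebraic D-variety over K, i.e. an affine algebraic variety X with a regular section s : X → TX of the tangent bundle, with associated K-linear derivation δ on the coordinate ring K[X]. If (X, s) has infinitely many D-subvarieties of pure codimension one, then there exists g ∈ K(X) \ K with δ(g) = 0, where δ denotes the unique extension of the derivation to the fraction field K(X). -/
/-!
# Jouanolou–Hrushovski theorem for algebraic D-varieties (Corollary 1.2)

An affine algebraic variety `X` over an algebraically closed field `K` of characteristic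
zero is modelled by its coordinate ring `R`: a finitely generated `K`-algebra which is an
integral domain.  A regular section `s : X → TX` of the tangent bundle corresponds to a
`K`-linear derivation `δ : R → R`.  A `D`-subvariety of pure codimension one corresponds to
a radical `δ`-invariant ideal of `R` all of whose minimal primes have height one
(a "hypersurface ideal").

The conclusion "`∃ g ∈ K(X) \ K` with `δ(g) = 0`" is expressed denominator-freely:
`g = a/b` with `b ≠ 0`, `g` is not the image of a constant `c ∈ K` (i.e. `a ≠ c·b` for all
`c`), and `δ(a/b) = 0` in `K(X)`, i.e. `δ(a)·b = a·δ(b)`.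
-/

/-- A prime ideal `P` of a commutative ring has height one. -/
def HeightOnePrime {R : Type*} [CommRing R] (P : Ideal R) : Prop :=
  P.IsPrime ∧ P ≠ ⊥ ∧ ∀ Q : Ideal R, Q.IsPrime → Q < P → Q = ⊥

/-- `I` is the radical vanishing ideal of a nonempty Zariski closed subset of pure
codimension one. -/
def IsHypersurfaceIdeal {R : Type*} [CommRing R] (I : Ideal R) : Prop :=
  I.IsRadical ∧ I ≠ ⊤ ∧ ∀ P ∈ I.minimalPrimes, HeightOnePrime P

section Bezoutian

open Polynomial

lemma coeff_divX_iterate {R : Type*} [CommRing R] (f : R[X]) (k i : ℕ) :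
    (divX^[k] f).coeff i = f.coeff (i + k) := by
  induction k generalizing f with
  | zero => simp
  | succ k ih => rw [Function.iterate_succ_apply, ih, coeff_divX]; congr 1

lemma natDegree_divX_iterate_le {R : Type*} [CommRing R] (f : R[X]) (k : ℕ) :
    (divX^[k] f).natDegree ≤ f.natDegree - k := by
  rw [natDegree_le_iff_coeff_eq_zero]
  intro i hi
  rw [coeff_divX_iterate]
  exact coeff_eq_zero_of_natDegree_lt (by omega)

lemma map_divX_iterate {R S : Type*} [CommRing R] [CommRing S] (φ : R →+* S) (f : R[X]) (k : ℕ) :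
    (divX^[k] f).map φ = divX^[k] (f.map φ) := by
  ext i
  simp [coeff_divX_iterate]

/-- The quotient `(f(X) - f(x)) / (X - x)`, for any `N` exceeding the degree of `f`. -/
noncomputable def bezoutian {R : Type*} [CommRing R] (N : ℕ) (f : R[X]) (x : R) : R[X] :=
  ∑ k ∈ Finset.range N, C (x ^ k) * divX^[k + 1] f

lemma coeff_bezoutian {R : Type*} [CommRing R] (N : ℕ) (f : R[X]) (x : R) (i : ℕ) :
    (bezoutian N f x).coeff i = ∑ k ∈ Finset.range N, x ^ k * f.coeff (i + (k + 1)) := by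
  simp only [bezoutian, finsetSum_coeff, coeff_C_mul, coeff_divX_iterate]

lemma coeff_bezoutian_eq_eval {R : Type*} [CommRing R] {N : ℕ} {f : R[X]} (hN : f.natDegree < N)
    (x : R) (i : ℕ) : (bezoutian N f x).coeff i = (divX^[i + 1] f).eval x := by
  rw [coeff_bezoutian, eval_eq_sum_range' (n := N)]
  · refine Finset.sum_congr rfl fun k _ => ?_
    rw [coeff_divX_iterate, mul_comm]
    congr 2
    ring
  · exact (natDegree_divX_iterate_le f (i + 1)).trans_lt (by omega)

lemma X_sub_C_mul_bezoutian {R : Type*} [CommRing R] {N : ℕ} {f : R[X]} (hN : f.natDegree < N)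
    (x : R) : (X - C x) * bezoutian N f x = f - C (f.eval x) := by
  have key : ∀ M : ℕ, (X - C x) * bezoutian M f x =
      f - C (x ^ M) * divX^[M] f - C (∑ k ∈ Finset.range M, f.coeff k * x ^ k) := by
    intro M
    induction M with
    | zero => simp [bezoutian]
    | succ M ih =>
      have h1 : divX^[M] f = X * divX^[M + 1] f + C (f.coeff M) := by
        conv_lhs => rw [← X_mul_divX_add (divX^[M] f)]
        rw [coeff_divX_iterate, zero_add, ← Function.iterate_succ_apply' divX]
      have h2 : bezoutian (M + 1) f x = bezoutian M f x + C (x ^ M) * divX^[M + 1] f := by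
        simp [bezoutian, Finset.sum_range_succ]
      rw [h2, mul_add, ih, h1, Finset.sum_range_succ]
      simp only [map_add, map_mul, map_pow]
      ring
  have h0 : divX^[N] f = 0 := by
    ext i
    rw [coeff_divX_iterate, coeff_zero]
    exact coeff_eq_zero_of_natDegree_lt (by omega)
  rw [key, h0, eval_eq_sum_range' hN]
  simp

/-- Euler's formula for the trace pairing of a power basis. -/
lemma PowerBasis.aeval_derivative_mul_eq_sum_trace {K E : Type*} [Field K] [Field E] [Algebra K E]
    [Algebra.IsSeparable K E] (pb : PowerBasis K E) {N : ℕ}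
    (hN : (minpoly K pb.gen).natDegree < N) (z : E) :
    aeval pb.gen (derivative (minpoly K pb.gen)) * z =
      ∑ i ∈ Finset.range N, algebraMap K E (Algebra.trace K E (pb.gen ^ i * z)) *
        aeval pb.gen (divX^[i + 1] (minpoly K pb.gen)) := by
  have : FiniteDimensional K E := pb.finite
  set x := pb.gen
  set f := minpoly K x with hf
  have hint : IsIntegral K x := Algebra.IsIntegral.isIntegral x
  have hdeg : (f.map (algebraMap K E)).natDegree < N := by rwa [natDegree_map]
  have hdiv : minpolyDiv K x = bezoutian N (f.map (algebraMap K E)) x := by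
    have h1 := X_sub_C_mul_bezoutian hdeg x
    have h2 : minpolyDiv K x * (X - C x) = f.map (algebraMap K E) := minpolyDiv_spec K x
    rw [eval_map_algebraMap, minpoly.aeval, map_zero, sub_zero, mul_comm] at h1
    exact mul_right_cancel₀ (X_sub_C_ne_zero x) (h2.trans h1.symm)
  have hcoeff : ∀ i, (minpolyDiv K x).coeff i = aeval x (divX^[i + 1] f) := by
    intro i
    rw [hdiv, coeff_bezoutian_eq_eval hdeg, ← map_divX_iterate, eval_map_algebraMap]
  have hsep : aeval x (derivative f) ≠ 0 :=
    (Algebra.IsSeparable.isSeparable K x).aeval_derivative_ne_zero (minpoly.aeval K x)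
  have hz := pb.basis.traceDual.sum_repr z
  simp only [Module.Basis.traceDual_repr_apply, Module.Basis.traceDual_powerBasis_eq,
    Algebra.traceForm_apply, PowerBasis.coe_basis] at hz
  conv_lhs => rw [← hz]
  rw [Finset.mul_sum]
  have hdim : pb.dim ≤ N := by rw [← pb.natDegree_minpoly]; exact hN.le
  have hle : ∑ i ∈ Finset.range N, algebraMap K E (Algebra.trace K E (x ^ i * z)) *
        aeval x (divX^[i + 1] f) = ∑ i ∈ Finset.range pb.dim,
          algebraMap K E (Algebra.trace K E (x ^ i * z)) * aeval x (divX^[i + 1] f) := by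
    symm
    refine Finset.sum_subset (Finset.range_subset_range.2 hdim) fun i _ hi => ?_
    rw [← hcoeff, coeff_eq_zero_of_natDegree_lt, mul_zero]
    have := natDegree_minpolyDiv_succ (R := K) hint
    rw [← hf, pb.natDegree_minpoly] at this
    simp only [Finset.mem_range] at hi
    omega
  rw [hle, Finset.sum_range]
  refine Finset.sum_congr rfl fun i _ => ?_
  change aeval x (derivative f) * (Algebra.trace K E (z * x ^ (i : ℕ)) •
    ((minpolyDiv K x).coeff i / aeval x (derivative f))) = _
  rw [hcoeff, Algebra.smul_def, mul_comm z]
  field_simp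

lemma PowerBasis.exists_sum_trace_eq_mul {K E : Type*} [Field K] [Field E] [Algebra K E]
    [Algebra.IsSeparable K E] (pb : PowerBasis K E) {f g : K[X]} {N : ℕ}
    (hf : f = minpoly K pb.gen * g) (hN : f.natDegree < N) (hg : g ≠ 0) :
    ∃ T : K[X], ∑ k ∈ Finset.range N, C (Algebra.trace K E (pb.gen ^ k)) * divX^[k + 1] f = g * T ∧
      aeval pb.gen T = aeval pb.gen (derivative (minpoly K pb.gen)) := by
  have : FiniteDimensional K E := pb.finite
  set x := pb.gen
  set m := minpoly K x with hm
  have hint : IsIntegral K x := Algebra.IsIntegral.isIntegral x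
  have hm0 : m ≠ 0 := minpoly.ne_zero hint
  have hNm : m.natDegree < N := by
    rw [hf, natDegree_mul hm0 hg] at hN
    omega
  refine ⟨∑ k ∈ Finset.range N, C (Algebra.trace K E (x ^ k)) * divX^[k + 1] m, ?_, ?_⟩
  · have hfx : aeval x f = 0 := by rw [hf, map_mul, minpoly.aeval, zero_mul]
    have hB : bezoutian N (f.map (algebraMap K E)) x =
        g.map (algebraMap K E) * bezoutian N (m.map (algebraMap K E)) x := by
      refine mul_left_cancel₀ (X_sub_C_ne_zero x) ?_
      rw [X_sub_C_mul_bezoutian (by rwa [natDegree_map]), mul_left_comm,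
        X_sub_C_mul_bezoutian (by rwa [natDegree_map]), eval_map_algebraMap, eval_map_algebraMap,
        hfx, minpoly.aeval, hf, Polynomial.map_mul]
      simp [mul_comm]
    have htr : ∀ (h : K[X]) (j : ℕ), (∑ k ∈ Finset.range N,
        C (Algebra.trace K E (x ^ k)) * divX^[k + 1] h).coeff j =
        Algebra.trace K E ((bezoutian N (h.map (algebraMap K E)) x).coeff j) := by
      intro h j
      simp only [finsetSum_coeff, coeff_C_mul, coeff_divX_iterate, coeff_bezoutian, map_sum,
        coeff_map]
      refine Finset.sum_congr rfl fun k _ => ?_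
      rw [mul_comm (x ^ k), ← Algebra.smul_def, map_smul, smul_eq_mul, mul_comm]
    ext j
    rw [htr, hB, coeff_mul, coeff_mul, map_sum]
    refine Finset.sum_congr rfl fun c _ => ?_
    rw [coeff_map, ← Algebra.smul_def, map_smul, smul_eq_mul, htr]
  · have := pb.aeval_derivative_mul_eq_sum_trace hNm 1
    rw [mul_one] at this
    rw [this, map_sum]
    simp [x, m]

end Bezoutian

section DegreeAtInfinity

open Polynomial

lemma MvPolynomial.totalDegree_mul_eq {σ K : Type*} [Field K] {f g : MvPolynomial σ K} (hf : f ≠ 0)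
    (hg : g ≠ 0) : (f * g).totalDegree = f.totalDegree + g.totalDegree :=
  MvPolynomial.totalDegree_mul_of_isDomain hf hg

/-- The valuation ring of minus the total degree. -/
def degreeValuationSubring (σ K : Type*) [Field K] :
    ValuationSubring (FractionRing (MvPolynomial σ K)) where
  carrier := {z | ∃ a b : MvPolynomial σ K, b ≠ 0 ∧ a.totalDegree ≤ b.totalDegree ∧
    z * algebraMap _ _ b = algebraMap _ _ a}
  mul_mem' := by
    rintro x y ⟨a, b, hb, h, e⟩ ⟨a', b', hb', h', e'⟩
    refine ⟨a * a', b * b', mul_ne_zero hb hb', ?_, ?_⟩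
    · rw [MvPolynomial.totalDegree_mul_eq hb hb']
      exact (MvPolynomial.totalDegree_mul _ _).trans (add_le_add h h')
    · rw [map_mul, map_mul, ← e, ← e']
      ring
  one_mem' := ⟨1, 1, one_ne_zero, le_rfl, by simp⟩
  add_mem' := by
    rintro x y ⟨a, b, hb, h, e⟩ ⟨a', b', hb', h', e'⟩
    refine ⟨a * b' + a' * b, b * b', mul_ne_zero hb hb', ?_, ?_⟩
    · rw [MvPolynomial.totalDegree_mul_eq hb hb']
      refine (MvPolynomial.totalDegree_add _ _).trans (max_le ?_ ?_)
      · exact (MvPolynomial.totalDegree_mul _ _).trans (by omega)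
      · exact (MvPolynomial.totalDegree_mul _ _).trans (by omega)
    · rw [map_add, map_mul, map_mul, map_mul, ← e, ← e']
      ring
  zero_mem' := ⟨0, 1, one_ne_zero, by simp, by simp⟩
  neg_mem' := by
    rintro x ⟨a, b, hb, h, e⟩
    exact ⟨-a, b, hb, by rwa [MvPolynomial.totalDegree_neg], by rw [map_neg, ← e, neg_mul]⟩
  mem_or_inv_mem' := by
    intro x
    obtain ⟨a, b, hb, rfl⟩ := IsFractionRing.div_surjective (A := MvPolynomial σ K) x
    have hb0 : b ≠ 0 := nonZeroDivisors.ne_zero hb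
    have hb' : algebraMap _ (FractionRing (MvPolynomial σ K)) b ≠ 0 := by simpa using hb0
    rcases le_total a.totalDegree b.totalDegree with h | h
    · exact Or.inl ⟨a, b, hb0, h, div_mul_cancel₀ _ hb'⟩
    · by_cases ha : a = 0
      · exact Or.inl ⟨0, 1, one_ne_zero, by simp, by simp [ha]⟩
      · have ha' : algebraMap _ (FractionRing (MvPolynomial σ K)) a ≠ 0 := by simpa using ha
        exact Or.inr ⟨b, a, ha, h, by rw [inv_div, div_mul_cancel₀ _ ha']⟩

lemma mem_degreeValuationSubring {σ K : Type*} [Field K]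
    {z : FractionRing (MvPolynomial σ K)} : z ∈ degreeValuationSubring σ K ↔
    ∃ a b : MvPolynomial σ K, b ≠ 0 ∧ a.totalDegree ≤ b.totalDegree ∧
      z * algebraMap _ _ b = algebraMap _ _ a := Iff.rfl

lemma algebraMap_degreeValuationSubring_mk {σ K : Type*} [Field K]
    {z : FractionRing (MvPolynomial σ K)} (h : z ∈ degreeValuationSubring σ K) :
    algebraMap (degreeValuationSubring σ K) (FractionRing (MvPolynomial σ K)) ⟨z, h⟩ = z := rfl

lemma div_X_pow_mem_degreeValuationSubring {σ K : Type*} [Field K] (s : σ) {N : ℕ}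
    {a : MvPolynomial σ K} : algebraMap _ (FractionRing (MvPolynomial σ K)) a /
      algebraMap (MvPolynomial σ K) _ (MvPolynomial.X s) ^ N ∈ degreeValuationSubring σ K ↔
        a.totalDegree ≤ N := by
  have hX : (MvPolynomial.X s : MvPolynomial σ K) ^ N ≠ 0 :=
    pow_ne_zero _ (MvPolynomial.X_ne_zero s)
  have hX' : algebraMap _ (FractionRing (MvPolynomial σ K))
      ((MvPolynomial.X s : MvPolynomial σ K) ^ N) ≠ 0 := by
    simp
  rw [mem_degreeValuationSubring, ← map_pow]
  constructor
  · rintro ⟨b, c, hc, h, e⟩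
    by_cases ha : a = 0
    · simp [ha]
    rw [div_mul_eq_mul_div, div_eq_iff hX', ← map_mul, ← map_mul] at e
    have e' := congrArg MvPolynomial.totalDegree (IsFractionRing.injective _ _ e)
    rw [MvPolynomial.totalDegree_mul_eq ha hc] at e'
    have := MvPolynomial.totalDegree_mul b (MvPolynomial.X s ^ N : MvPolynomial σ K)
    rw [MvPolynomial.totalDegree_X_pow] at this
    omega
  · intro h
    exact ⟨a, _, hX, by rwa [MvPolynomial.totalDegree_X_pow], div_mul_cancel₀ _ hX'⟩

lemma isIntegral_of_pow_add_sum_eq_zero {V E : Type*} [CommRing V] [CommRing E] [Algebra V E]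
    {d : ℕ} {z : E} {α : Fin d → E} (hα : ∀ i, IsIntegral V (α i))
    (h : z ^ d + ∑ i : Fin d, α i * z ^ (i : ℕ) = 0) : IsIntegral V z := by
  refine isIntegral_trans (A := integralClosure V E) z
    ⟨X ^ d + ∑ i : Fin d, C ⟨α i, hα i⟩ * X ^ (i : ℕ), monic_X_pow_add ?_, ?_⟩
  · exact degree_sum_fin_lt fun i => (⟨α i, hα i⟩ : integralClosure V E)
  · rw [← aeval_def, map_add, map_pow, aeval_X, map_sum, ← h]
    congr 1
    refine Finset.sum_congr rfl fun i _ => ?_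
    simp

lemma totalDegree_le_of_isIntegral_trace {σ K E : Type*} [Field K] [Field E]
    [Algebra (FractionRing (MvPolynomial σ K)) E]
    [FiniteDimensional (FractionRing (MvPolynomial σ K)) E]
    [Algebra (degreeValuationSubring σ K) E]
    [IsScalarTower (degreeValuationSubring σ K) (FractionRing (MvPolynomial σ K)) E] (s : σ) (N : ℕ)
    {t : MvPolynomial σ K} {w : E}
    (hw : IsIntegral (degreeValuationSubring σ K)
      (w / algebraMap (FractionRing (MvPolynomial σ K)) E
      (algebraMap (MvPolynomial σ K) _ (MvPolynomial.X s)) ^ N))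
    (ht : algebraMap (MvPolynomial σ K) (FractionRing (MvPolynomial σ K)) t =
      Algebra.trace (FractionRing (MvPolynomial σ K)) E w) :
    t.totalDegree ≤ N := by
  have h1 := Algebra.isIntegral_trace (L := FractionRing (MvPolynomial σ K)) hw
  obtain ⟨y, hy⟩ := IsIntegrallyClosed.isIntegral_iff.1 h1
  rw [← div_X_pow_mem_degreeValuationSubring s, ht]
  convert y.2
  change _ = algebraMap _ (FractionRing (MvPolynomial σ K)) y
  rw [hy, ← map_pow, ← map_pow, div_eq_inv_mul w, ← map_inv₀, ← Algebra.smul_def, map_smul,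
    smul_eq_mul,
    div_eq_inv_mul, map_pow]

/-- Weighted degree bound on a polynomial in `X` over a polynomial ring, `X` having weight one. -/
def WeightLE {σ K : Type*} [Field K] (N : ℕ) (f : (MvPolynomial σ K)[X]) : Prop :=
  ∀ i, f.coeff i ≠ 0 → (f.coeff i).totalDegree + i ≤ N

lemma WeightLE.mono {σ K : Type*} [Field K] {N M : ℕ} (h : N ≤ M) {f : (MvPolynomial σ K)[X]}
    (hf : WeightLE N f) : WeightLE M f := fun i hi => (hf i hi).trans h

lemma WeightLE.zero {σ K : Type*} [Field K] (N : ℕ) : WeightLE N (0 : (MvPolynomial σ K)[X]) :=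
  fun i hi => (hi (coeff_zero i)).elim

lemma WeightLE.add {σ K : Type*} [Field K] {N : ℕ} {f g : (MvPolynomial σ K)[X]}
    (hf : WeightLE N f) (hg : WeightLE N g) : WeightLE N (f + g) := by
  intro i hi
  rw [coeff_add] at hi ⊢
  by_cases h1 : f.coeff i = 0
  · rw [h1, zero_add] at hi ⊢
    exact hg i hi
  by_cases h2 : g.coeff i = 0
  · rw [h2, add_zero] at hi ⊢
    exact hf i hi
  have := MvPolynomial.totalDegree_add (f.coeff i) (g.coeff i)
  have := hf i h1
  have := hg i h2
  omega

lemma WeightLE.sum {σ K ι : Type*} [Field K] {N : ℕ} (s : Finset ι) (f : ι → (MvPolynomial σ K)[X])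
    (hf : ∀ i ∈ s, WeightLE N (f i)) : WeightLE N (∑ i ∈ s, f i) :=
  Finset.sum_induction f (WeightLE N) (fun _ _ => WeightLE.add) (WeightLE.zero N) hf

lemma WeightLE.mul {σ K : Type*} [Field K] {N M : ℕ} {f g : (MvPolynomial σ K)[X]}
    (hf : WeightLE N f) (hg : WeightLE M g) : WeightLE (N + M) (f * g) := by
  intro i hi
  have : (f * g).coeff i ≠ 0 → i ≤ N + M := by
    intro hi
    rw [coeff_mul] at hi
    obtain ⟨c, hc, hne⟩ := Finset.exists_ne_zero_of_sum_ne_zero hi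
    have h1 := hf c.1 (left_ne_zero_of_mul hne)
    have h2 := hg c.2 (right_ne_zero_of_mul hne)
    have := Finset.HasAntidiagonal.mem_antidiagonal.1 hc
    omega
  have hle := this hi
  suffices (((f * g).coeff i)).totalDegree ≤ N + M - i by omega
  rw [coeff_mul]
  refine MvPolynomial.totalDegree_finsetSum_le fun c hc => ?_
  have hc := Finset.HasAntidiagonal.mem_antidiagonal.1 hc
  by_cases h1 : f.coeff c.1 = 0
  · simp [h1]
  by_cases h2 : g.coeff c.2 = 0
  · simp [h2]
  have := hf _ h1
  have := hg _ h2
  exact (MvPolynomial.totalDegree_mul _ _).trans (by omega)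

lemma WeightLE.isIntegral {σ K E : Type*} [Field K] [Field E]
    [Algebra (MvPolynomial σ K) E]
    [Algebra (FractionRing (MvPolynomial σ K)) E]
    [IsScalarTower (MvPolynomial σ K) (FractionRing (MvPolynomial σ K)) E]
    [Algebra (degreeValuationSubring σ K) E]
    [IsScalarTower (degreeValuationSubring σ K) (FractionRing (MvPolynomial σ K)) E] (s : σ)
    {θ : E} (hθ : IsIntegral (degreeValuationSubring σ K)
      (θ / algebraMap (MvPolynomial σ K) E (MvPolynomial.X s)))
    {N : ℕ} {f : (MvPolynomial σ K)[X]} (hf : WeightLE N f) :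
    IsIntegral (degreeValuationSubring σ K)
      (aeval θ f / algebraMap (MvPolynomial σ K) E (MvPolynomial.X s) ^ N) := by
  have hl : algebraMap (MvPolynomial σ K) E (MvPolynomial.X s) ≠ 0 := by
    rw [IsScalarTower.algebraMap_apply _ (FractionRing (MvPolynomial σ K)) E]
    simp [MvPolynomial.X_ne_zero]
  rw [aeval_eq_sum_range, Finset.sum_div]
  refine IsIntegral.sum _ fun i _ => ?_
  by_cases h0 : f.coeff i = 0
  · simp [h0, isIntegral_zero]
  have hi := hf i h0
  have : f.coeff i • θ ^ i / algebraMap (MvPolynomial σ K) E (MvPolynomial.X s) ^ N =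
      algebraMap (MvPolynomial σ K) E (f.coeff i) /
        algebraMap (MvPolynomial σ K) E (MvPolynomial.X s) ^ (N - i) *
        (θ / algebraMap (MvPolynomial σ K) E (MvPolynomial.X s)) ^ i := by
    obtain ⟨j, rfl⟩ : ∃ j, N = j + i := ⟨N - i, by omega⟩
    rw [Nat.add_sub_cancel, Algebra.smul_def, pow_add, div_pow]
    field_simp
  rw [this]
  refine IsIntegral.mul ?_ (hθ.pow i)
  have hmem := (div_X_pow_mem_degreeValuationSubring s (N := N - i) (a := f.coeff i)).2 (by omega)
  have : algebraMap (MvPolynomial σ K) E (f.coeff i) /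
        algebraMap (MvPolynomial σ K) E (MvPolynomial.X s) ^ (N - i) =
      algebraMap (degreeValuationSubring σ K) E ⟨_, hmem⟩ := by
    rw [IsScalarTower.algebraMap_apply (degreeValuationSubring σ K)
      (FractionRing (MvPolynomial σ K)) E]
    rw [algebraMap_degreeValuationSubring_mk, map_div₀, map_pow,
      ← IsScalarTower.algebraMap_apply, ← IsScalarTower.algebraMap_apply]
  rw [this]
  exact isIntegral_algebraMap

end DegreeAtInfinity

section TraceBound

open Polynomial

lemma isIntegral_div_pow_of_pow_add_sum_eq_zero {V E : Type*} [CommRing V] [Field E] [Algebra V E]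
    {d c : ℕ} {z l : E} {β : Fin d → E}
    (hβ : ∀ i : Fin d, IsIntegral V (β i / l ^ (c * (d - i))))
    (h : z ^ d + ∑ i : Fin d, β i * z ^ (i : ℕ) = 0) : IsIntegral V (z / l ^ c) := by
  refine isIntegral_of_pow_add_sum_eq_zero hβ ?_
  have h2 : (z ^ d + ∑ i : Fin d, β i * z ^ (i : ℕ)) / l ^ (c * d) = 0 := by rw [h, zero_div]
  rw [← h2, add_div, Finset.sum_div, div_pow, ← pow_mul]
  congr 1
  refine Finset.sum_congr rfl fun i _ => ?_
  obtain ⟨j, hj⟩ : ∃ j, d = j + i := ⟨d - i, by omega⟩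
  have hj' : d - i = j := by omega
  have hd : l ^ (c * d) = l ^ (c * j) * l ^ (c * i) := by rw [← pow_add, ← mul_add, ← hj]
  rw [hj', hd, div_pow, ← pow_mul, div_mul_div_comm]

lemma Polynomial.Monic.eval₂_eq_pow_add_sum {R S : Type*} [CommRing R] [CommRing S] (φ : R →+* S)
    {F : R[X]} (hF : F.Monic) (y : S) :
    eval₂ φ y F = y ^ F.natDegree + ∑ i : Fin F.natDegree, φ (F.coeff i) * y ^ (i : ℕ) := by
  rw [eval₂_eq_sum_range, Finset.sum_range_succ, hF.coeff_natDegree, map_one, one_mul, add_comm,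
    Finset.sum_range]

lemma WeightLE.C_mul_divX_iterate {σ K : Type*} [Field K] {m : (MvPolynomial σ K)[X]} {D N i : ℕ}
    (hm : WeightLE D m) {t : MvPolynomial σ K} (ht : t.totalDegree ≤ i + N) :
    WeightLE (D + N) (C t * divX^[i + 1] m) := by
  intro j hj
  rw [coeff_C_mul, coeff_divX_iterate] at hj ⊢
  have := hm _ (right_ne_zero_of_mul hj)
  have := MvPolynomial.totalDegree_mul t (m.coeff (j + (i + 1)))
  omega

section Tower

variable {n : ℕ} {K κ E : Type*} [Field K] [CharZero K] [Field κ] [Field E]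
  [Algebra (MvPolynomial (Fin n) K) κ] [Algebra (FractionRing (MvPolynomial (Fin n) K)) κ]
  [IsScalarTower (MvPolynomial (Fin n) K) (FractionRing (MvPolynomial (Fin n) K)) κ]
  [Algebra κ E] [FiniteDimensional κ E]
  [Algebra (MvPolynomial (Fin n) K) E] [Algebra (FractionRing (MvPolynomial (Fin n) K)) E]
  [IsScalarTower (MvPolynomial (Fin n) K) (FractionRing (MvPolynomial (Fin n) K)) E]
  [IsScalarTower (FractionRing (MvPolynomial (Fin n) K)) κ E]
  [Algebra (degreeValuationSubring (Fin n) K) E]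
  [IsScalarTower (degreeValuationSubring (Fin n) K) (FractionRing (MvPolynomial (Fin n) K)) E]

lemma exists_weightLE_aeval_eq_mul_trace_of_tower {θ : κ}
    {m : (MvPolynomial (Fin n) K)[X]} (hm : m.Monic) (hirr : Irreducible m)
    (hθ : aeval θ m = 0) (hgen : Algebra.adjoin (FractionRing (MvPolynomial (Fin n) K)) {θ} = ⊤)
    (hw : WeightLE m.natDegree m) {F : (MvPolynomial (Fin n) K)[X][X]} (hF : F.Monic) {c : ℕ}
    (hFw : ∀ i < F.natDegree, WeightLE (c * (F.natDegree - i)) (F.coeff i)) {Y : E}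
    (hY : eval₂ ((algebraMap κ E).comp (aeval θ).toRingHom) Y F = 0) (k : ℕ) :
    ∃ q : (MvPolynomial (Fin n) K)[X], WeightLE (m.natDegree + c * k) q ∧
      aeval θ q = aeval θ (derivative m) * Algebra.trace κ E (Y ^ k) := by
  let A' := MvPolynomial (Fin n) K
  let k' := FractionRing A'
  let V := degreeValuationSubring (Fin n) K
  have : IsScalarTower A' κ E := IsScalarTower.of_algebraMap_eq fun a => by
    rw [IsScalarTower.algebraMap_apply A' k' E, IsScalarTower.algebraMap_apply k' κ E,
      ← IsScalarTower.algebraMap_apply A' k' κ]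
  set θ' : E := algebraMap κ E θ with hθ'
  have haev : ∀ f : A'[X], algebraMap κ E (aeval θ f) = aeval θ' f := fun f => by
    rw [hθ', aeval_algebraMap_apply]
  have hint : IsIntegral k' θ := ⟨m.map (algebraMap A' k'), hm.map _, by
    rw [← aeval_def, aeval_map_algebraMap, hθ]⟩
  have hmin : minpoly k' θ = m.map (algebraMap A' k') := by
    symm
    refine minpoly.eq_of_irreducible_of_monic
      ((hm.irreducible_iff_irreducible_map_fraction_map (K := k')).1 hirr) ?_ (hm.map _)
    rw [aeval_map_algebraMap, hθ]
  let pb : PowerBasis k' κ := PowerBasis.ofAdjoinEqTop hint hgen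
  have hpb : pb.gen = θ := PowerBasis.ofAdjoinEqTop_gen hint hgen
  have : FiniteDimensional k' κ := pb.finite
  have : FiniteDimensional k' E := FiniteDimensional.trans k' κ E
  set τ := Algebra.trace κ E (Y ^ k) with hτ
  have hEuler := pb.aeval_derivative_mul_eq_sum_trace (N := m.natDegree + 1)
    (by rw [hpb, hmin, hm.natDegree_map]; omega) τ
  rw [hpb, hmin, derivative_map, aeval_map_algebraMap] at hEuler
  have htr : ∀ i, Algebra.trace k' κ (θ ^ i * τ) = Algebra.trace k' E (θ' ^ i * Y ^ k) := by
    intro i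
    rw [← Algebra.trace_trace (S := κ) (θ' ^ i * Y ^ k), hθ', ← map_pow, ← Algebra.smul_def,
      map_smul, smul_eq_mul]
  have hYeq := hF.eval₂_eq_pow_add_sum ((algebraMap κ E).comp (aeval θ).toRingHom) Y
  rw [hY] at hYeq
  have hθeq := hm.eval₂_eq_pow_add_sum (algebraMap A' E) θ'
  rw [← aeval_def, ← haev, hθ, map_zero] at hθeq
  have hθint : IsIntegral A' θ' := ⟨m, hm, by rw [← aeval_def, ← haev, hθ, map_zero]⟩
  have hYint : IsIntegral A' Y := by
    refine isIntegral_of_pow_add_sum_eq_zero (fun i => ?_) hYeq.symm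
    change IsIntegral A' (algebraMap κ E (aeval θ (F.coeff i)))
    rw [haev]
    rw [aeval_eq_sum_range]
    exact IsIntegral.sum _ fun j _ => (hθint.pow j).smul _
  have ht : ∀ i, ∃ t : A', algebraMap A' k' t = Algebra.trace k' E (θ' ^ i * Y ^ k) := fun i =>
    IsIntegrallyClosed.isIntegral_iff.1 (Algebra.isIntegral_trace ((hθint.pow i).mul (hYint.pow k)))
  choose t ht using ht
  have hdeg : ∀ i, (t i).totalDegree ≤ i + c * k := by
    rcases Nat.eq_zero_or_pos n with rfl | hn
    · intro i
      have h0 : ∀ q : MvPolynomial (Fin 0) K, q.totalDegree = 0 := fun q => by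
        rw [MvPolynomial.eq_C_of_isEmpty q, MvPolynomial.totalDegree_C]
      rw [h0]
      omega
    · let s : Fin n := ⟨0, hn⟩
      let ℓ : E := algebraMap A' E (MvPolynomial.X s)
      have h1 : IsIntegral V (θ' / ℓ) := by
        rw [← pow_one ℓ]
        refine isIntegral_div_pow_of_pow_add_sum_eq_zero (fun i => ?_) hθeq.symm
        by_cases h0 : m.coeff i = 0
        · rw [h0, map_zero, zero_div]
          exact isIntegral_zero
        have hmem := (div_X_pow_mem_degreeValuationSubring s (N := 1 * (m.natDegree - i))
          (a := m.coeff i)).2 (by have := hw i h0; omega)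
        have : algebraMap A' E (m.coeff i) / ℓ ^ (1 * (m.natDegree - i)) =
            algebraMap V E ⟨_, hmem⟩ := by
          rw [IsScalarTower.algebraMap_apply V k' E, algebraMap_degreeValuationSubring_mk,
            map_div₀, map_pow, ← IsScalarTower.algebraMap_apply, ← IsScalarTower.algebraMap_apply]
        rw [this]
        exact isIntegral_algebraMap
      have h2 : IsIntegral V (Y / ℓ ^ c) := by
        refine isIntegral_div_pow_of_pow_add_sum_eq_zero (fun i => ?_) hYeq.symm
        change IsIntegral V (algebraMap κ E (aeval θ (F.coeff i)) / _)
        rw [haev]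
        exact WeightLE.isIntegral s h1 (hFw i i.2)
      intro i
      refine totalDegree_le_of_isIntegral_trace s _ ?_ (ht i)
      have := (h1.pow i).mul (h2.pow k)
      rw [div_pow, div_pow, div_mul_div_comm, ← pow_mul, ← pow_add] at this
      rwa [← IsScalarTower.algebraMap_apply A' k' E]
  refine ⟨∑ i ∈ Finset.range (m.natDegree + 1), C (t i) * divX^[i + 1] m,
    WeightLE.sum _ _ fun i _ => hw.C_mul_divX_iterate (hdeg i), ?_⟩
  rw [hEuler, map_sum]
  refine Finset.sum_congr rfl fun i _ => ?_
  rw [map_mul, aeval_C, htr, ← ht, ← IsScalarTower.algebraMap_apply, ← map_divX_iterate,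
    aeval_map_algebraMap]

end Tower

lemma exists_weightLE_map_eq_mul_trace {n : ℕ} {K κ E : Type*} [Field K] [CharZero K] [Field κ]
    [Field E] [Algebra κ E] [FiniteDimensional κ E] (φ : (MvPolynomial (Fin n) K)[X] →+* κ)
    (hfrac : ∀ z, ∃ a b, φ b ≠ 0 ∧ z = φ a / φ b) {m : (MvPolynomial (Fin n) K)[X]} (hm : m.Monic)
    (hker : RingHom.ker φ = Ideal.span {m})
    (hw : WeightLE m.natDegree m) {F : (MvPolynomial (Fin n) K)[X][X]} (hF : F.Monic) {c : ℕ}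
    (hFw : ∀ i < F.natDegree, WeightLE (c * (F.natDegree - i)) (F.coeff i)) {Y : E}
    (hY : eval₂ ((algebraMap κ E).comp φ) Y F = 0) (k : ℕ) :
    ∃ q : (MvPolynomial (Fin n) K)[X], WeightLE (m.natDegree + c * k) q ∧
      φ q = φ (derivative m) * Algebra.trace κ E (Y ^ k) := by
  let A' := MvPolynomial (Fin n) K
  let k' := FractionRing A'
  let V := degreeValuationSubring (Fin n) K
  have hmem : ∀ f, φ f = 0 ↔ m ∣ f := fun f => by
    rw [← RingHom.mem_ker, hker, Ideal.mem_span_singleton]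
  have hprime : Prime m := by
    rw [← Ideal.span_singleton_prime hm.ne_zero, ← hker]
    exact RingHom.ker_isPrime φ
  have hpos : 0 < m.natDegree := by
    rw [Nat.pos_iff_ne_zero]
    intro h
    exact hprime.not_isUnit (by rw [hm.natDegree_eq_zero.1 h]; exact isUnit_one)
  have hinj : Function.Injective (φ.comp C) := by
    rw [injective_iff_map_eq_zero]
    intro a ha
    by_contra h0
    have := natDegree_le_of_dvd ((hmem (C a)).1 ha) (C_ne_zero.2 h0)
    rw [natDegree_C] at this
    omega
  let _ : Algebra A' κ := (φ.comp C).toAlgebra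
  let _ : Algebra k' κ := (IsFractionRing.lift hinj).toAlgebra
  have : IsScalarTower A' k' κ := IsScalarTower.of_algebraMap_eq fun a =>
    (IsFractionRing.lift_algebraMap hinj a).symm
  let _ : Algebra k' E := ((algebraMap κ E).comp (algebraMap k' κ)).toAlgebra
  have : IsScalarTower k' κ E := IsScalarTower.of_algebraMap_eq' rfl
  let _ : Algebra A' E := ((algebraMap k' E).comp (algebraMap A' k')).toAlgebra
  have : IsScalarTower A' k' E := IsScalarTower.of_algebraMap_eq' rfl
  let _ : Algebra V E := ((algebraMap k' E).comp (algebraMap V k')).toAlgebra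
  have : IsScalarTower V k' E := IsScalarTower.of_algebraMap_eq' rfl
  have hφ : (aeval (φ X) : A'[X] →ₐ[A'] κ).toRingHom = φ := by
    refine Polynomial.ringHom_ext (fun a => ?_) ?_
    · change aeval (φ X) (C a) = φ (C a)
      rw [aeval_C]
      rfl
    · exact aeval_X _
  have hφ' : ∀ f, aeval (φ X) f = φ f := fun f => congrArg (fun g : A'[X] →+* κ => g f) hφ
  have hgen : Algebra.adjoin k' {φ X} = ⊤ := by
    have hint : IsIntegral k' (φ X) := by
      refine ⟨m.map (algebraMap A' k'), hm.map _, ?_⟩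
      rw [← aeval_def, aeval_map_algebraMap, hφ', hmem]
    have hφmem : ∀ f, φ f ∈ Algebra.adjoin k' {φ X} := fun f => by
      rw [← hφ' f, ← aeval_map_algebraMap k' (φ X) f]
      exact aeval_mem_adjoin_singleton k' _
    rw [eq_top_iff]
    rintro z -
    obtain ⟨a, b, hb, rfl⟩ := hfrac z
    rw [div_eq_mul_inv]
    refine mul_mem (hφmem a) ?_
    exact Subalgebra.inv_mem_of_algebraic _ (x := ⟨φ b, hφmem b⟩)
      (IsIntegral.isAlgebraic (adjoin_le_integralClosure hint (hφmem b)))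
  have := exists_weightLE_aeval_eq_mul_trace_of_tower hm hprime.irreducible
    (by rw [hφ', hmem]) hgen hw hF hFw (Y := Y) (by rw [hφ]; exact hY) k
  simpa only [hφ'] using this

end TraceBound

section Directions

open Polynomial

lemma MvPolynomial.totalDegree_aeval_le {σ τ K : Type*} [Field K]
    {g : σ → MvPolynomial τ K} (hg : ∀ i, (g i).totalDegree ≤ 1) (f : MvPolynomial σ K) :
    (MvPolynomial.aeval g f).totalDegree ≤ f.totalDegree := by
  rw [MvPolynomial.aeval_def, MvPolynomial.eval₂_eq]
  refine MvPolynomial.totalDegree_finsetSum_le fun s hs => ?_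
  refine (MvPolynomial.totalDegree_mul _ _).trans ?_
  rw [MvPolynomial.algebraMap_eq, MvPolynomial.totalDegree_C, zero_add]
  refine (MvPolynomial.totalDegree_finsetProd _ _).trans ?_
  refine le_trans (Finset.sum_le_sum fun i _ => ?_) (MvPolynomial.le_totalDegree hs)
  refine (MvPolynomial.totalDegree_pow _ _).trans ?_
  exact (Nat.mul_le_mul_left _ (hg i)).trans (mul_one _).le

lemma coeff_aeval_C_mul_X {σ K : Type*} [Field K] (u : σ → K) (N : ℕ)
    (f : MvPolynomial σ K) : (MvPolynomial.aeval (fun j => C (u j) * X) f : K[X]).coeff N =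
      MvPolynomial.eval u (MvPolynomial.homogeneousComponent N f) := by
  induction f using MvPolynomial.induction_on' with
  | add p q hp hq => simp only [map_add, coeff_add, hp, hq]
  | monomial s a =>
    have h1 : (MvPolynomial.aeval (fun j => C (u j) * X) (MvPolynomial.monomial s a) : K[X]) =
        C (MvPolynomial.eval u (MvPolynomial.monomial s a)) * X ^ s.degree := by
      rw [MvPolynomial.aeval_monomial, MvPolynomial.eval_monomial, Finsupp.prod, Finsupp.prod,
        map_mul, map_prod, Finsupp.degree_apply, ← Finset.prod_pow_eq_pow_sum, mul_assoc,
        ← Finset.prod_mul_distrib]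
      simp [mul_pow]
    rw [h1, coeff_C_mul_X_pow, MvPolynomial.homogeneousComponent_of_mem
      (MvPolynomial.isHomogeneous_monomial a rfl)]
    split_ifs <;> simp

lemma weightLE_C {σ K : Type*} [Field K] {N : ℕ} {t : MvPolynomial σ K} (ht : t.totalDegree ≤ N) :
    WeightLE N (C t) := by
  intro i hi
  rw [coeff_C] at hi ⊢
  split_ifs at hi ⊢ with h
  · omega
  · exact (hi rfl).elim

lemma weightLE_X {σ K : Type*} [Field K] : WeightLE 1 (X : (MvPolynomial σ K)[X]) := by
  intro i hi
  rw [coeff_X] at hi ⊢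
  split_ifs at hi ⊢ with h
  · simp [← h]
  · exact (hi rfl).elim

lemma WeightLE.pow {σ K : Type*} [Field K] {N : ℕ} {f : (MvPolynomial σ K)[X]}
    (hf : WeightLE N f) (k : ℕ) : WeightLE (k * N) (f ^ k) := by
  induction k with
  | zero => simpa using weightLE_C (σ := σ) (K := K) (t := 1) (N := 0) (by simp)
  | succ k ih =>
    rw [pow_succ, add_mul, one_mul]
    exact ih.mul hf

lemma WeightLE.prod {σ K ι : Type*} [Field K] (s : Finset ι) (N : ι → ℕ)
    (f : ι → (MvPolynomial σ K)[X]) (hf : ∀ i ∈ s, WeightLE (N i) (f i)) :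
    WeightLE (∑ i ∈ s, N i) (∏ i ∈ s, f i) := by
  classical
  induction s using Finset.induction_on with
  | empty => simpa using weightLE_C (σ := σ) (K := K) (t := 1) (N := 0) (by simp)
  | insert a s ha ih =>
    rw [Finset.sum_insert ha, Finset.prod_insert ha]
    exact (hf a (Finset.mem_insert_self a s)).mul
      (ih fun i hi => hf i (Finset.mem_insert_of_mem hi))

lemma weightLE_aeval {σ τ K : Type*} [Field K]
    {g : σ → (MvPolynomial τ K)[X]} (hg : ∀ i, WeightLE 1 (g i)) (f : MvPolynomial σ K) {N : ℕ}
    (hN : f.totalDegree ≤ N) : WeightLE N (MvPolynomial.aeval g f) := by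
  rw [MvPolynomial.aeval_def, MvPolynomial.eval₂_eq]
  refine WeightLE.sum _ _ fun s hs => WeightLE.mono hN ?_
  rw [← zero_add f.totalDegree]
  refine WeightLE.mul (weightLE_C (t := MvPolynomial.C (f.coeff s)) (by simp)) ?_
  refine WeightLE.mono ?_ (WeightLE.prod s.support (fun i => s i) _ fun i _ => ?_)
  · exact MvPolynomial.le_totalDegree hs
  · simpa using (hg i).pow (s i)

/-- The variables of a polynomial ring along and transversally to a direction `u`. -/
noncomputable def directionVar {n : ℕ} {K : Type*} [Field K] (u : Fin (n + 1) → K) :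
    Fin (n + 1) → (MvPolynomial (Fin n) K)[X] :=
  fun i => C (Fin.cons (α := fun _ => MvPolynomial (Fin n) K) 0 MvPolynomial.X i) +
    C (MvPolynomial.C (u i)) * X

lemma weightLE_directionVar {n : ℕ} {K : Type*} [Field K] (u : Fin (n + 1) → K) (i : Fin (n + 1)) :
    WeightLE 1 (directionVar u i) := by
  refine WeightLE.add (weightLE_C ?_) (WeightLE.mul (N := 0) (weightLE_C (by simp)) weightLE_X)
  refine Fin.cases ?_ (fun j => ?_) i
  · simp
  · simp

/-- The inverse of the change of variables `directionVar u`, when `u 0 ≠ 0`. -/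
noncomputable def directionInv {n : ℕ} {K : Type*} [Field K] (u : Fin (n + 1) → K) :
    (MvPolynomial (Fin n) K)[X] →ₐ[K] MvPolynomial (Fin (n + 1)) K :=
  aevalTower (MvPolynomial.aeval fun j : Fin n => MvPolynomial.X j.succ -
    MvPolynomial.C (u j.succ / u 0) * MvPolynomial.X 0) (MvPolynomial.C (u 0)⁻¹ * MvPolynomial.X 0)

lemma directionInv_C {n : ℕ} {K : Type*} [Field K] (u : Fin (n + 1) → K)
    (f : MvPolynomial (Fin n) K) : directionInv u (C f) = MvPolynomial.aeval (fun j : Fin n =>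
      MvPolynomial.X j.succ - MvPolynomial.C (u j.succ / u 0) * MvPolynomial.X 0) f :=
  aevalTower_C _ _ f

lemma directionInv_X {n : ℕ} {K : Type*} [Field K] (u : Fin (n + 1) → K) :
    directionInv u X = MvPolynomial.C (u 0)⁻¹ * MvPolynomial.X 0 :=
  aevalTower_X _ _

/-- A linear change of variables straightening a direction `u` with nonvanishing first
coordinate. -/
noncomputable def directionEquiv {n : ℕ} {K : Type*} [Field K] (u : Fin (n + 1) → K)
    (hu : u 0 ≠ 0) : MvPolynomial (Fin (n + 1)) K ≃ₐ[K] (MvPolynomial (Fin n) K)[X] :=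
  have h0 : MvPolynomial.aeval (directionVar u) (MvPolynomial.X 0) =
      C (MvPolynomial.C (u 0)) * X := by simp [directionVar]
  have hC : ∀ a : K, MvPolynomial.aeval (directionVar u) (MvPolynomial.C a) =
      C (MvPolynomial.C a) := fun a => by
    rw [MvPolynomial.aeval_C]
    rfl
  have hC' : ∀ a : K, directionInv u (C (MvPolynomial.C a)) = MvPolynomial.C a := fun a => by
    rw [directionInv_C, MvPolynomial.aeval_C]
    rfl
  AlgEquiv.ofAlgHom (MvPolynomial.aeval (directionVar u)) (directionInv u)
    (by
      refine Polynomial.algHom_ext' (MvPolynomial.algHom_ext fun j => ?_) ?_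
      · change MvPolynomial.aeval (directionVar u) (directionInv u (C (MvPolynomial.X j))) =
          C (MvPolynomial.X j)
        rw [directionInv_C, MvPolynomial.aeval_X, map_sub, map_mul, h0, hC, MvPolynomial.aeval_X,
          ← mul_assoc, ← C_mul, ← MvPolynomial.C_mul, div_mul_cancel₀ _ hu]
        simp [directionVar]
      · change MvPolynomial.aeval (directionVar u) (directionInv u X) = X
        rw [directionInv_X, map_mul, h0, hC, ← mul_assoc, ← C_mul, ← MvPolynomial.C_mul,
          inv_mul_cancel₀ hu]
        simp)
    (by
      refine MvPolynomial.algHom_ext fun i => ?_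
      change directionInv u (MvPolynomial.aeval (directionVar u) (MvPolynomial.X i)) =
        MvPolynomial.X i
      rw [MvPolynomial.aeval_X, directionVar, map_add, map_mul, hC', directionInv_X, ← mul_assoc,
        ← MvPolynomial.C_mul, ← div_eq_mul_inv, directionInv_C]
      refine Fin.cases ?_ (fun j => ?_) i
      · simp [div_self hu]
      · simp)

lemma totalDegree_directionInv_le {n : ℕ} {K : Type*} [Field K] (u : Fin (n + 1) → K) {N : ℕ}
    {f : (MvPolynomial (Fin n) K)[X]} (hf : WeightLE N f) : (directionInv u f).totalDegree ≤ N := by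
  have hlin : ∀ (a : K) (i : Fin (n + 1)),
      (MvPolynomial.C a * MvPolynomial.X i : MvPolynomial (Fin (n + 1)) K).totalDegree ≤ 1 :=
    fun a i => (MvPolynomial.totalDegree_mul _ _).trans (by simp)
  conv_lhs => rw [f.as_sum_range_C_mul_X_pow]
  rw [map_sum]
  refine MvPolynomial.totalDegree_finsetSum_le fun i _ => ?_
  by_cases h0 : f.coeff i = 0
  · simp [h0]
  rw [map_mul, map_pow, directionInv_C, directionInv_X]
  refine (MvPolynomial.totalDegree_mul _ _).trans (le_trans (add_le_add ?_ ?_) (hf i h0))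
  · refine MvPolynomial.totalDegree_aeval_le (fun j => ?_) _
    exact (MvPolynomial.totalDegree_sub _ _).trans (max_le (by simp) (hlin _ _))
  · refine (MvPolynomial.totalDegree_pow _ _).trans ?_
    exact (Nat.mul_le_mul_left _ (hlin _ _)).trans (mul_one _).le

lemma derivative_aeval_directionVar {n : ℕ} {K : Type*} [Field K] (u : Fin (n + 1) → K)
    (f : MvPolynomial (Fin (n + 1)) K) :
    derivative (MvPolynomial.aeval (directionVar u) f) =
      MvPolynomial.aeval (directionVar u)
        (∑ j, MvPolynomial.C (u j) * MvPolynomial.pderiv j f) := by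
  induction f using MvPolynomial.induction_on with
  | C a => simp [Polynomial.algebraMap_apply]
  | add p q hp hq => simp only [map_add, hp, hq, mul_add, Finset.sum_add_distrib]
  | mul_X p i hp =>
    have h1 : ∑ j, MvPolynomial.C (u j) * MvPolynomial.pderiv j (p * MvPolynomial.X i) =
        (∑ j, MvPolynomial.C (u j) * MvPolynomial.pderiv j p) * MvPolynomial.X i +
          p * MvPolynomial.C (u i) := by
      rw [Finset.sum_mul]
      have : p * MvPolynomial.C (u i) =
          ∑ j, MvPolynomial.C (u j) * (p * MvPolynomial.pderiv j (MvPolynomial.X i)) := by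
        rw [Finset.sum_eq_single i]
        · simp [mul_comm]
        · intro j _ hj
          rw [MvPolynomial.pderiv_X_of_ne hj.symm]
          simp
        · simp
      rw [this, ← Finset.sum_add_distrib]
      refine Finset.sum_congr rfl fun j _ => ?_
      rw [MvPolynomial.pderiv_mul]
      ring
    have h2 : derivative (directionVar u i) = C (MvPolynomial.C (u i)) := by
      rw [directionVar, derivative_add, derivative_C, zero_add, derivative_C_mul, derivative_X,
        mul_one]
    have h3 : MvPolynomial.aeval (directionVar u) (MvPolynomial.C (u i)) =
        C (MvPolynomial.C (u i)) := by
      rw [MvPolynomial.aeval_C]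
      rfl
    have hmul := map_mul (MvPolynomial.aeval (R := K) (directionVar u))
    rw [h1, map_add, hmul, hmul, hmul, h3, MvPolynomial.aeval_X, derivative_mul, hp, h2]

lemma coeff_aeval_directionVar {n : ℕ} {K : Type*} [Field K] (u : Fin (n + 1) → K)
    (f : MvPolynomial (Fin (n + 1)) K) :
    (MvPolynomial.aeval (directionVar u) f).coeff f.totalDegree =
      MvPolynomial.C (MvPolynomial.eval u (MvPolynomial.homogeneousComponent f.totalDegree f)) := by
  have h := weightLE_aeval (weightLE_directionVar u) f le_rfl f.totalDegree
  have h0 : ((MvPolynomial.aeval (directionVar u) f).coeff f.totalDegree).totalDegree = 0 := by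
    by_contra h0
    have := h (by rintro h; simp [h] at h0)
    omega
  have h1 : (mapRingHom MvPolynomial.constantCoeff).comp
      (MvPolynomial.aeval (directionVar u)).toRingHom =
      (MvPolynomial.aeval (fun j => C (u j) * X) :
        MvPolynomial (Fin (n + 1)) K →ₐ[K] K[X]).toRingHom := by
    refine MvPolynomial.ringHom_ext (fun a => ?_) (fun i => ?_)
    · change Polynomial.map _ (MvPolynomial.aeval (directionVar u) (MvPolynomial.C a)) =
        MvPolynomial.aeval _ (MvPolynomial.C a)
      simp [Polynomial.algebraMap_apply]
    · change Polynomial.map _ (MvPolynomial.aeval (directionVar u) (MvPolynomial.X i)) =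
        MvPolynomial.aeval _ (MvPolynomial.X i)
      refine Fin.cases ?_ (fun j => ?_) i <;> simp [directionVar]
  have h2 := congrArg (fun g => (g f).coeff f.totalDegree) h1
  rw [MvPolynomial.totalDegree_eq_zero_iff_eq_C.1 h0, ← coeff_aeval_C_mul_X]
  exact congrArg MvPolynomial.C ((coeff_map _ _).symm.trans h2)

lemma exists_totalDegree_le_map_eq_mul_trace_of_direction {n : ℕ} {K κ E : Type*} [Field K]
    [CharZero K] [Field κ] [Field E] [Algebra κ E] [FiniteDimensional κ E]
    (π : MvPolynomial (Fin (n + 1)) K →+* κ) (hfrac : ∀ z, ∃ a b, π b ≠ 0 ∧ z = π a / π b)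
    {p : MvPolynomial (Fin (n + 1)) K} (hker : RingHom.ker π = Ideal.span {p})
    {u : Fin (n + 1) → K} (hu : u 0 ≠ 0)
    (hpu : MvPolynomial.eval u (MvPolynomial.homogeneousComponent p.totalDegree p) ≠ 0)
    {F : (MvPolynomial (Fin (n + 1)) K)[X]} (hF : F.Monic) {c : ℕ}
    (hFc : ∀ i < F.natDegree, (F.coeff i).totalDegree ≤ c * (F.natDegree - i)) {Y : E}
    (hY : eval₂ ((algebraMap κ E).comp π) Y F = 0) (k : ℕ) :
    ∃ q : MvPolynomial (Fin (n + 1)) K, q.totalDegree ≤ p.totalDegree + c * k ∧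
      π q = π (∑ j, MvPolynomial.C (u j) * MvPolynomial.pderiv j p) *
        Algebra.trace κ E (Y ^ k) := by
  set c0 := MvPolynomial.eval u (MvPolynomial.homogeneousComponent p.totalDegree p) with hc0
  let ψ := directionEquiv u hu
  have hψ : ∀ f, ψ f = MvPolynomial.aeval (directionVar u) f := fun _ => rfl
  have hψC : ∀ a : K, ψ (MvPolynomial.C a) = C (MvPolynomial.C a) := fun a => by
    rw [hψ, MvPolynomial.aeval_C]
    rfl
  have hψC' : ∀ a : K, ψ.symm (C (MvPolynomial.C a)) = MvPolynomial.C a := fun a => by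
    rw [← hψC, ψ.symm_apply_apply]
  have hcoeff : (ψ p).coeff p.totalDegree = MvPolynomial.C c0 := coeff_aeval_directionVar u p
  have hwp : WeightLE p.totalDegree (ψ p) := weightLE_aeval (weightLE_directionVar u) p le_rfl
  have hne : (MvPolynomial.C c0 : MvPolynomial (Fin n) K) ≠ 0 := by simpa using hpu
  have hψdeg : (ψ p).natDegree = p.totalDegree := by
    refine natDegree_eq_of_le_of_coeff_ne_zero ?_ (by rwa [hcoeff])
    rw [natDegree_le_iff_coeff_eq_zero]
    intro i hi
    by_contra h0
    have := hwp i h0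
    omega
  set m : (MvPolynomial (Fin n) K)[X] := C (MvPolynomial.C c0⁻¹) * ψ p with hm
  have hunit : MvPolynomial.C c0⁻¹ * MvPolynomial.C c0 = (1 : MvPolynomial (Fin n) K) := by
    rw [← MvPolynomial.C_mul, inv_mul_cancel₀ hpu, MvPolynomial.C_1]
  have hunit' : MvPolynomial.C c0 * MvPolynomial.C c0⁻¹ = (1 : MvPolynomial (Fin (n + 1)) K) := by
    rw [← MvPolynomial.C_mul, mul_inv_cancel₀ hpu, MvPolynomial.C_1]
  have hne' : (MvPolynomial.C c0⁻¹ : MvPolynomial (Fin n) K) ≠ 0 := left_ne_zero_of_mul_eq_one hunit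
  have hmdeg : m.natDegree = p.totalDegree := by rw [hm, natDegree_C_mul hne', hψdeg]
  have hmonic : m.Monic := by
    rw [Monic, leadingCoeff, hmdeg, hm, coeff_C_mul, hcoeff, hunit]
  have hwm : WeightLE m.natDegree m := by
    rw [hmdeg, ← zero_add p.totalDegree]
    exact (weightLE_C (by simp)).mul hwp
  have hmp : ψ p = C (MvPolynomial.C c0) * m := by
    rw [hm, ← mul_assoc, ← C_mul, mul_comm (MvPolynomial.C c0), hunit, C_1, one_mul]
  have hpm : ψ.symm m = MvPolynomial.C c0⁻¹ * p := by
    rw [hm, map_mul, hψC', ψ.symm_apply_apply]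
  have hkerm : RingHom.ker (π.comp (ψ.symm : _ →+* _)) = Ideal.span {m} := by
    ext f
    rw [RingHom.mem_ker, Ideal.mem_span_singleton]
    change π (ψ.symm f) = 0 ↔ _
    rw [← RingHom.mem_ker, hker, Ideal.mem_span_singleton]
    constructor
    · rintro ⟨g, hg⟩
      refine ⟨C (MvPolynomial.C c0) * ψ g, ?_⟩
      rw [← ψ.apply_symm_apply f, hg, map_mul, hmp]
      ring
    · rintro ⟨g, hg⟩
      refine ⟨MvPolynomial.C c0⁻¹ * ψ.symm g, ?_⟩
      rw [hg, map_mul, hpm]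
      ring
  have hdm : ψ.symm (derivative m) = MvPolynomial.C c0⁻¹ *
      ∑ j, MvPolynomial.C (u j) * MvPolynomial.pderiv j p := by
    rw [hm, derivative_C_mul, hψ, derivative_aeval_directionVar, ← hψ, map_mul, hψC',
      ψ.symm_apply_apply]
  obtain ⟨q, hq, hqe⟩ := exists_weightLE_map_eq_mul_trace (π.comp (ψ.symm : _ →+* _)) (m := m)
    (F := F.map (ψ : _ →+* _)) (c := c) (Y := Y)
    (fun z => by
      obtain ⟨a, b, hb, hz⟩ := hfrac z
      refine ⟨ψ a, ψ b, ?_, ?_⟩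
      · change π (ψ.symm (ψ b)) ≠ 0
        rwa [ψ.symm_apply_apply]
      · change z = π (ψ.symm (ψ a)) / π (ψ.symm (ψ b))
        rwa [ψ.symm_apply_apply, ψ.symm_apply_apply]) hmonic hkerm hwm (hF.map _)
    (fun i hi => by
      rw [hF.natDegree_map] at hi ⊢
      rw [coeff_map]
      exact weightLE_aeval (weightLE_directionVar u) _ (hFc i hi))
    (by
      rw [eval₂_map, ← hY]
      congr 1
      refine RingHom.ext fun a => ?_
      change algebraMap κ E (π (ψ.symm (ψ a))) = _
      rw [ψ.symm_apply_apply]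
      rfl) k
  refine ⟨MvPolynomial.C c0 * ψ.symm q, ?_, ?_⟩
  · refine (MvPolynomial.totalDegree_mul _ _).trans ?_
    rw [MvPolynomial.totalDegree_C, zero_add, ← hmdeg]
    exact totalDegree_directionInv_le u hq
  · rw [map_mul]
    change π _ * (π.comp (ψ.symm : _ →+* _)) q = _
    rw [hqe]
    change π _ * (π (ψ.symm (derivative m)) * _) = _
    rw [hdm, ← mul_assoc, ← map_mul, ← mul_assoc, hunit', one_mul]

lemma MvPolynomial.exists_eval_ne_zero {σ K : Type*} [Field K] [Infinite K]
    {f : MvPolynomial σ K} (hf : f ≠ 0) : ∃ u, MvPolynomial.eval u f ≠ 0 := by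
  by_contra! h
  exact hf (MvPolynomial.funext fun u => by rw [h u, map_zero])

lemma MvPolynomial.exists_eval_add_single_ne_zero {σ K : Type*} [Field K] [Infinite K]
    [DecidableEq σ] {f : MvPolynomial σ K} {u : σ → K} (hu : MvPolynomial.eval u f ≠ 0) (j : σ) :
    ∃ t : K, t ≠ 0 ∧ MvPolynomial.eval (u + Pi.single j t) f ≠ 0 := by
  let g : K[X] := MvPolynomial.aeval
    (fun i => Polynomial.C (u i) + (Pi.single j Polynomial.X : σ → K[X]) i) f
  have hg : ∀ t, g.eval t = MvPolynomial.eval (u + Pi.single j t) f := by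
    intro t
    have h1 : (Polynomial.evalRingHom t).comp (MvPolynomial.aeval (R := K)
        (fun i => Polynomial.C (u i) + (Pi.single j Polynomial.X : σ → K[X]) i)).toRingHom =
        MvPolynomial.eval (u + Pi.single j t) := by
      refine MvPolynomial.ringHom_ext (fun a => ?_) (fun i => ?_)
      · change Polynomial.eval t (MvPolynomial.aeval _ (MvPolynomial.C a)) = _
        rw [MvPolynomial.aeval_C, MvPolynomial.eval_C]
        exact Polynomial.eval_C
      · change Polynomial.eval t (MvPolynomial.aeval _ (MvPolynomial.X i)) = _
        rw [MvPolynomial.aeval_X, MvPolynomial.eval_X, Polynomial.eval_add, Polynomial.eval_C]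
        by_cases h : i = j
        · subst h
          simp
        · simp [h]
    exact congrArg (fun φ : MvPolynomial σ K →+* K => φ f) h1
  have hg0 : Polynomial.X * g ≠ 0 := by
    refine mul_ne_zero Polynomial.X_ne_zero fun h => hu ?_
    have := hg 0
    rw [h, Polynomial.eval_zero, Pi.single_zero, add_zero] at this
    exact this.symm
  obtain ⟨t, ht⟩ : ∃ t, (Polynomial.X * g).eval t ≠ 0 := by
    by_contra! h
    exact hg0 (Polynomial.funext fun t => by rw [h t, Polynomial.eval_zero])
  rw [Polynomial.eval_mul, Polynomial.eval_X, hg] at ht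
  exact ⟨t, left_ne_zero_of_mul ht, right_ne_zero_of_mul ht⟩

/-- Modulo an irreducible polynomial `p`, the product of a partial derivative of `p` and the trace
of a power of an integral element is represented by a polynomial of controlled degree. -/
lemma exists_totalDegree_le_map_eq_mul_trace {n : ℕ} {K κ E : Type*} [Field K]
    [CharZero K] [Field κ] [Field E] [Algebra κ E] [FiniteDimensional κ E]
    (π : MvPolynomial (Fin (n + 1)) K →+* κ) (hfrac : ∀ z, ∃ a b, π b ≠ 0 ∧ z = π a / π b)
    {p : MvPolynomial (Fin (n + 1)) K} (hp : p ≠ 0) (hker : RingHom.ker π = Ideal.span {p})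
    {F : (MvPolynomial (Fin (n + 1)) K)[X]} (hF : F.Monic) {c : ℕ}
    (hFc : ∀ i < F.natDegree, (F.coeff i).totalDegree ≤ c * (F.natDegree - i)) {Y : E}
    (hY : eval₂ ((algebraMap κ E).comp π) Y F = 0) (j : Fin (n + 1)) (k : ℕ) :
    ∃ q : MvPolynomial (Fin (n + 1)) K, q.totalDegree ≤ p.totalDegree + c * k ∧
      π q = π (MvPolynomial.pderiv j p) * Algebra.trace κ E (Y ^ k) := by
  have hinf : Infinite K := CharZero.infinite K
  have htop : MvPolynomial.homogeneousComponent p.totalDegree p ≠ 0 := by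
    obtain ⟨s, hs, hsd⟩ := Finset.exists_mem_eq_sup p.support
      (MvPolynomial.support_nonempty.2 hp) fun s => s.sum fun _ e => e
    intro h0
    have := congrArg (MvPolynomial.coeff s) h0
    rw [MvPolynomial.coeff_homogeneousComponent, MvPolynomial.coeff_zero,
      if_pos (show s.degree = p.totalDegree from hsd.symm)] at this
    exact MvPolynomial.mem_support_iff.1 hs this
  obtain ⟨u, hu⟩ := MvPolynomial.exists_eval_ne_zero
    (mul_ne_zero htop (MvPolynomial.X_ne_zero (0 : Fin (n + 1))))
  obtain ⟨t, ht, htu⟩ := MvPolynomial.exists_eval_add_single_ne_zero hu j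
  rw [map_mul, MvPolynomial.eval_X] at hu htu
  obtain ⟨q, hq, hqe⟩ := exists_totalDegree_le_map_eq_mul_trace_of_direction π hfrac hker
    (right_ne_zero_of_mul hu) (left_ne_zero_of_mul hu) hF hFc hY k
  obtain ⟨r, hr, hre⟩ := exists_totalDegree_le_map_eq_mul_trace_of_direction π hfrac hker
    (right_ne_zero_of_mul htu) (left_ne_zero_of_mul htu) hF hFc hY k
  refine ⟨MvPolynomial.C t⁻¹ * (r - q), ?_, ?_⟩
  · refine (MvPolynomial.totalDegree_mul _ _).trans ?_
    rw [MvPolynomial.totalDegree_C, zero_add]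
    exact (MvPolynomial.totalDegree_sub _ _).trans (max_le hr hq)
  · rw [map_mul, map_sub, hre, hqe, ← sub_mul, ← map_sub, ← mul_assoc, ← map_mul]
    congr 2
    rw [← Finset.sum_sub_distrib, Finset.sum_eq_single j]
    · rw [← sub_mul, ← map_sub, ← mul_assoc, ← map_mul]
      simp [ht]
    · intro i _ hi
      simp [hi]
    · simp

end Directions

section LocalIdempotent

open Polynomial

lemma Polynomial.exists_map_eq_C_mul {A κ : Type*} [CommRing A] [Field κ] (π : A →+* κ)
    (hfrac : ∀ z, ∃ a b, π b ≠ 0 ∧ z = π a / π b) (f : κ[X]) :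
    ∃ (s : A) (g : A[X]), π s ≠ 0 ∧ g.map π = C (π s) * f := by
  induction f using Polynomial.induction_on' with
  | add p q hp hq =>
    obtain ⟨s, g, hs, hg⟩ := hp
    obtain ⟨t, h, ht, hh⟩ := hq
    refine ⟨s * t, C t * g + C s * h, by simp [hs, ht], ?_⟩
    simp only [Polynomial.map_add, Polynomial.map_mul, map_C, hg, hh, map_mul]
    ring
  | monomial n z =>
    obtain ⟨a, b, hb, rfl⟩ := hfrac z
    refine ⟨b, monomial n a, hb, ?_⟩
    rw [map_monomial, C_mul_monomial, mul_div_cancel₀ _ hb]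

/-- The idempotent cutting out the factor `minpoly κ pb.gen` of a separable polynomial `F` over
`κ`, up to denominators, together with its relation to traces. -/
lemma exists_idempotent_mod {A κ E : Type*} [CommRing A] [Field κ] [CharZero κ] [Field E]
    [Algebra κ E] (π : A →+* κ) (hfrac : ∀ z, ∃ a b, π b ≠ 0 ∧ z = π a / π b)
    (pb : PowerBasis κ E) {F : A[X]} (hF : F.Monic) (hsep : (F.map π).Separable)
    (hy : eval₂ ((algebraMap κ E).comp π) pb.gen F = 0) {N : ℕ} (hN : F.natDegree < N) :
    ∃ (s : A) (f : A[X]), π s ≠ 0 ∧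
      (∀ h : A[X], eval₂ ((algebraMap κ E).comp π) pb.gen h = 0 → F.map π ∣ (f * h).map π) ∧
      (F.map π ∣ (f * f - C s * f).map π) ∧ (¬ F.map π ∣ f.map π) ∧
      (∀ (a : A) (g : A[X]), g.map π = C (π a) * ∑ k ∈ Finset.range N,
          C (Algebra.trace κ E (pb.gen ^ k)) * divX^[k + 1] (F.map π) →
        F.map π ∣ (f * C a * derivative F - C s * g).map π) := by
  have : FiniteDimensional κ E := pb.finite
  have hroot : ∀ h : A[X], eval₂ ((algebraMap κ E).comp π) pb.gen h = aeval pb.gen (h.map π) :=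
    fun h => by rw [aeval_def, eval₂_map]
  set F₁ := minpoly κ pb.gen with hF₁
  obtain ⟨F₂, hF₂⟩ : F₁ ∣ F.map π := minpoly.dvd κ _ (by rw [← hroot, hy])
  have hF0 : F.map π ≠ 0 := (hF.map π).ne_zero
  have hF₂0 : F₂ ≠ 0 := fun h => hF0 (by rw [hF₂, h, mul_zero])
  obtain ⟨u, v, huv⟩ : IsCoprime F₁ F₂ := by
    rw [hF₂] at hsep
    exact hsep.isCoprime
  obtain ⟨s, f, hs, hf⟩ := Polynomial.exists_map_eq_C_mul π hfrac (v * F₂)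
  refine ⟨s, f, hs, ?_, ?_, ?_, ?_⟩
  · intro h hh
    obtain ⟨w, hw⟩ : F₁ ∣ h.map π := minpoly.dvd κ _ (by rw [← hroot, hh])
    refine ⟨C (π s) * v * w, ?_⟩
    rw [Polynomial.map_mul, hf, hw, hF₂]
    ring
  · refine ⟨- C (π s) * C (π s) * u * v, ?_⟩
    rw [Polynomial.map_sub, Polynomial.map_mul, Polynomial.map_mul, map_C, hf, hF₂]
    linear_combination C (π s) * C (π s) * v * F₂ * huv
  · rintro ⟨w, hw⟩
    have h1 : F₂ * (C (π s) * v) = F₂ * (F₁ * w) := by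
      rw [← mul_assoc F₂ F₁, mul_comm F₂ F₁, ← hF₂, ← hw, hf]
      ring
    have h2 := mul_left_cancel₀ hF₂0 h1
    have h3 : F₁ ∣ C (π s) := ⟨C (π s) * u + w * F₂, by
      linear_combination - C (π s) * huv + F₂ * h2⟩
    have h4 : F₁ ∣ 1 := by
      refine h3.trans ⟨C (π s)⁻¹, ?_⟩
      rw [← C_mul, mul_inv_cancel₀ hs, C_1]
    exact minpoly.not_isUnit κ pb.gen (isUnit_of_dvd_one h4)
  · intro a g hg
    obtain ⟨T, hT, hTa⟩ := pb.exists_sum_trace_eq_mul hF₂ (by rwa [hF.natDegree_map]) hF₂0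
    obtain ⟨w, hw⟩ : F₁ ∣ T - derivative F₁ := minpoly.dvd κ _ (by rw [map_sub, hTa, sub_self])
    refine ⟨C (π s) * C (π a) * (v * derivative F₂ - u * derivative F₁ - w), ?_⟩
    have hd : derivative (F.map π) = derivative F₁ * F₂ + F₁ * derivative F₂ := by
      rw [hF₂, derivative_mul]
    rw [Polynomial.map_sub, Polynomial.map_mul, Polynomial.map_mul, Polynomial.map_mul, map_C,
      map_C, hf, hg, hT, ← derivative_map, hd, hF₂]
    linear_combination C (π s) * C (π a) * derivative F₁ * F₂ * huv - C (π s) * C (π a) * F₂ * hw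

lemma Polynomial.exists_aeval_eq_mul_of_dvd_map {A κ L : Type*} [CommRing A] [CommRing κ]
    [CommRing L] [Algebra A L] (π : A →+* κ) {p : A} (hker : RingHom.ker π = Ideal.span {p})
    {F : A[X]} (hF : F.Monic) {y : L} (hy : aeval y F = 0) {h : A[X]} (hdvd : F.map π ∣ h.map π) :
    ∃ r : A[X], aeval y h = algebraMap A L p * aeval y r := by
  have h0 : (h %ₘ F).map π = 0 := by
    rw [map_modByMonic _ hF]
    exact (modByMonic_eq_zero_iff_dvd (hF.map π)).2 hdvd
  have h1 : C p ∣ h %ₘ F := by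
    rw [C_dvd_iff_dvd_coeff]
    intro i
    rw [← Ideal.mem_span_singleton, ← hker, RingHom.mem_ker, ← coeff_map, h0, coeff_zero]
  obtain ⟨r, hr⟩ := h1
  refine ⟨r, ?_⟩
  conv_lhs => rw [← modByMonic_add_div h F, map_add, map_mul, hy, zero_mul, add_zero, hr]
  rw [map_mul, aeval_C]

end LocalIdempotent

section ExtendDerivation

lemma Derivation.exists_extension {K A L : Type*} [CommRing K] [CommRing A] [CommRing L]
    [Algebra K A] [Algebra K L] [Algebra A L] [IsScalarTower K A L] [Algebra.FormallyEtale A L]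
    (D : Derivation K A L) : ∃ D' : Derivation K L L, ∀ a, D' (algebraMap A L a) = D a := by
  refine ⟨LinearMap.compDer (LinearMap.liftBaseChangeEquiv L D.liftKaehlerDifferential ∘ₗ
    (KaehlerDifferential.tensorKaehlerEquivOfFormallyEtale K A L).symm.toLinearMap)
      (KaehlerDifferential.D K L), fun a => ?_⟩
  change LinearMap.liftBaseChangeEquiv L D.liftKaehlerDifferential
    ((KaehlerDifferential.tensorKaehlerEquivOfFormallyEtale K A L).symm
      (KaehlerDifferential.D K L (algebraMap A L a))) = D a
  rw [KaehlerDifferential.tensorKaehlerEquivOfFormallyEtale_symm_D_algebraMap]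
  simp

lemma Derivation.ext_of_formallyUnramified {K A L : Type*} [CommRing K] [CommRing A] [CommRing L]
    [Algebra K A] [Algebra K L] [Algebra A L] [IsScalarTower K A L] [Algebra.FormallyUnramified A L]
    {D D' : Derivation K L L} (h : ∀ a, D (algebraMap A L a) = D' (algebraMap A L a)) : D = D' := by
  let d : Derivation A L L := Derivation.mk' { toFun := D - D'
                                               map_add' := map_add (D - D')
                                               map_smul' := fun a x => by
                                                simp [Algebra.smul_def, h, mul_sub] } fun x y => by
      change D (x * y) - D' (x * y) = x * (D y - D' y) + y * (D x - D' x)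
      simp only [Derivation.leibniz, smul_eq_mul]
      ring
  have h1 : d = 0 := by
    have : d.liftKaehlerDifferential = 0 := LinearMap.ext fun x => by
      rw [Subsingleton.elim x 0, map_zero, map_zero]
    ext x
    rw [← d.liftKaehlerDifferential_comp_D, this]
    rfl
  ext x
  have := Derivation.congr_fun h1 x
  exact sub_eq_zero.1 this

lemma formallyEtale_of_isIntegral {A R L : Type*} [CommRing A] [IsDomain A] [CharZero A]
    [CommRing R] [IsDomain R] [Algebra A R] [Algebra.IsIntegral A R] [FaithfulSMul A R] [Field L]
    [Algebra R L] [IsFractionRing R L] [Algebra A L] [IsScalarTower A R L] :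
    Algebra.FormallyEtale A L := by
  have : FaithfulSMul A L := by
    rw [faithfulSMul_iff_algebraMap_injective, IsScalarTower.algebraMap_eq A R L]
    exact (IsFractionRing.injective R L).comp (FaithfulSMul.algebraMap_injective A R)
  let _ : Algebra (FractionRing A) L := FractionRing.liftAlgebra A L
  have : Algebra.IsAlgebraic (FractionRing A) L :=
    isAlgebraic_of_isFractionRing A R _ _
  have : CharZero (FractionRing A) :=
    charZero_of_injective_algebraMap (IsFractionRing.injective A _)
  have := Algebra.FormallyEtale.of_isLocalization (Rₘ := FractionRing A) (nonZeroDivisors A)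
  have := Algebra.FormallyEtale.of_isSeparable (FractionRing A) L
  exact Algebra.FormallyEtale.comp A (FractionRing A) L

lemma MvPolynomial.exists_extend_pderiv {σ K L : Type*} [Fintype σ] [CommRing K] [CommRing L]
    [Algebra K L] [Algebra (MvPolynomial σ K) L] [IsScalarTower K (MvPolynomial σ K) L]
    [Algebra.FormallyEtale (MvPolynomial σ K) L] :
    ∃ D : σ → Derivation K L L,
      (∀ j a, D j (algebraMap (MvPolynomial σ K) L a) = algebraMap _ L (MvPolynomial.pderiv j a)) ∧
      (∀ i j z, D i (D j z) = D j (D i z)) ∧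
      ∀ (d : Derivation K L L) (z : L),
        d z = ∑ j, d (algebraMap (MvPolynomial σ K) L (MvPolynomial.X j)) * D j z := by
  classical
  let ι : MvPolynomial σ K →ₗ[MvPolynomial σ K] L := Algebra.linearMap _ L
  choose D hD using fun j : σ => Derivation.exists_extension
    (ι.compDer (MvPolynomial.pderiv (R := K) j))
  have hD' : ∀ j a, D j (algebraMap (MvPolynomial σ K) L a) =
      algebraMap _ L (MvPolynomial.pderiv j a) := fun j a => hD j a
  refine ⟨D, hD', fun i j z => ?_, fun d z => ?_⟩
  · have h : ⁅D i, D j⁆ = 0 := Derivation.ext_of_formallyUnramified (A := MvPolynomial σ K)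
      fun a => by
      rw [Derivation.commutator_apply, hD', hD', hD', hD']
      have h0 : (⁅MvPolynomial.pderiv (R := K) i, MvPolynomial.pderiv (R := K) j⁆ :
          Derivation K (MvPolynomial σ K) (MvPolynomial σ K)) = 0 := by
        refine MvPolynomial.derivation_ext fun k => ?_
        rw [Derivation.commutator_apply, MvPolynomial.pderiv_X, MvPolynomial.pderiv_X]
        simp [Pi.single_apply, apply_ite]
      have := Derivation.congr_fun h0 a
      rw [Derivation.commutator_apply] at this
      rw [← map_sub, this]
      simp
    have := Derivation.congr_fun h z
    rw [Derivation.commutator_apply] at this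
    exact sub_eq_zero.1 this
  · let d' : Derivation K L L := ∑ j, d (algebraMap (MvPolynomial σ K) L (MvPolynomial.X j)) • D j
    have hd' : ∀ z, d' z = ∑ j, d (algebraMap (MvPolynomial σ K) L (MvPolynomial.X j)) * D j z :=
      fun z => by
        rw [← Derivation.coeFnAddMonoidHom_apply, map_sum, Finset.sum_apply]
        rfl
    rw [← hd']
    refine Derivation.congr_fun ?_ z
    refine Derivation.ext_of_formallyUnramified (A := MvPolynomial σ K) fun a => ?_
    rw [hd']
    have h0 : d.compAlgebraMap (MvPolynomial σ K) =
        (d'.compAlgebraMap (MvPolynomial σ K)) := by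
      refine MvPolynomial.derivation_ext fun k => ?_
      change d (algebraMap _ L (MvPolynomial.X k)) = d' (algebraMap _ L (MvPolynomial.X k))
      rw [hd']
      simp only [hD', MvPolynomial.pderiv_X]
      simp [Pi.single_apply, apply_ite]
    rw [← hd']
    exact Derivation.congr_fun h0 a

end ExtendDerivation

section LocalForms

open Polynomial

lemma Subring.derivation_mul_div_sub_mem {K L J : Type*} [CommRing K] [Field L] [Algebra K L]
    (O : Subring L) {p e : L} (hp0 : p ≠ 0) (hp : p ∈ O) (he : e ∈ O) (he2 : (e * e - e) / p ∈ O)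
    (D : J → Derivation K L L) (hDO : ∀ j, ∀ g ∈ O, D j g ∈ O)
    (hcomm : ∀ i j z, D i (D j z) = D j (D i z)) {η : J → L}
    (hη : ∀ j, η j - e * D j p / p ∈ O) (i j : J) : D i (η j) - D j (η i) ∈ O := by
  obtain ⟨x, hx, hxe⟩ : ∃ x ∈ O, e * e = e + p * x :=
    ⟨_, he2, by field_simp; ring⟩
  obtain ⟨e', he', z, hz, hzz, w, hw, hww⟩ : ∃ e' ∈ O, ∃ z ∈ O, e' = e + p * z ∧
      ∃ w ∈ O, e' * e' - e' = p * p * w := by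
    have h2 : (2 : L) ∈ O := ofNat_mem O 2
    have h3 : (3 : L) ∈ O := ofNat_mem O 3
    have h1 : (1 : L) ∈ O := one_mem O
    refine ⟨3 * (e * e) - 2 * (e * e * e), ?_, x * (1 - 2 * e), ?_, ?_,
      - (x * x * (3 - 2 * e) * (2 * e + 1)), ?_, ?_⟩
    · exact sub_mem (mul_mem h3 (mul_mem he he)) (mul_mem h2 (mul_mem (mul_mem he he) he))
    · exact mul_mem hx (sub_mem h1 (mul_mem h2 he))
    · linear_combination (1 - 2 * e) * hxe
    · exact neg_mem (mul_mem (mul_mem (mul_mem hx hx) (sub_mem h3 (mul_mem h2 he)))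
        (add_mem (mul_mem h2 he) h1))
    · linear_combination (-(e * e - e) - p * x) * (3 - 2 * e) * (2 * e + 1) * hxe
  have hD : ∀ j, ∃ v ∈ O, D j e' = p * v := fun j => by
    have h := congrArg (D j) hww
    have h2 : (2 : L) ∈ O := ofNat_mem O 2
    have h4 : (4 : L) ∈ O := ofNat_mem O 4
    have hE := hDO j _ he'
    have hP := hDO j _ hp
    have hW := hDO j _ hw
    simp only [map_sub, Derivation.leibniz, smul_eq_mul] at h
    refine ⟨(2 * e' - 1) * (p * D j w + 2 * (w * D j p)) - 4 * (p * w * D j e'), ?_, ?_⟩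
    · exact sub_mem (mul_mem (sub_mem (mul_mem h2 he') (one_mem O))
        (add_mem (mul_mem hp hW) (mul_mem h2 (mul_mem hw hP))))
        (mul_mem h4 (mul_mem (mul_mem hp hw) hE))
    · linear_combination (2 * e' - 1) * h - 4 * D j e' * hww
  have hη' : ∀ j, ∃ u ∈ O, p * η j = p * u + e' * D j p := fun j =>
    ⟨η j - e * D j p / p - z * D j p, sub_mem (hη j) (mul_mem hz (hDO j _ hp)), by
      rw [hzz]; field_simp; ring⟩
  choose u hu huη using hη'
  choose v hv hve using hD
  have key : ∀ i j, p * D i (η j) = p * D i (u j) + p * v i * D j p + e' * D i (D j p)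
      - v j * p * D i p + (u j - η j) * D i p + v j * p * D i p := fun i j => by
    have h := congrArg (D i) (huη j)
    simp only [map_add, Derivation.leibniz, smul_eq_mul, hve] at h
    linear_combination h
  have h1 : D i (η j) - D j (η i) = D i (u j) - D j (u i) + v i * D j p - v j * D i p := by
    have hij := key i j
    have hji := key j i
    rw [hcomm j i p] at hji
    have : p * ((D i (η j) - D j (η i)) -
        (D i (u j) - D j (u i) + v i * D j p - v j * D i p)) = 0 := by
      have h5 : p * ((u j - η j) * D i p - (u i - η i) * D j p) = 0 := by
        linear_combination D j p * huη i - D i p * huη j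
      have h6 := (mul_eq_zero.1 h5).resolve_left hp0
      linear_combination hij - hji + h6
    exact sub_eq_zero.1 ((mul_eq_zero.1 this).resolve_left hp0)
  rw [h1]
  exact sub_mem (add_mem (sub_mem (hDO i _ (hu j)) (hDO j _ (hu i)))
    (mul_mem (hv i) (hDO j _ hp))) (mul_mem (hv j) (hDO i _ hp))

/-- The elements of `L` which become polynomials in `y` over `A` after multiplication with some
element not divisible by the prime `p`. -/
def localAdjoin {A L : Type*} [CommRing A] [Field L] [Algebra A L] (y : L) {p : A}
    (hp : Prime p) : Subalgebra A L where
  carrier := {g | ∃ s, ¬ p ∣ s ∧ s • g ∈ Algebra.adjoin A {y}}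
  mul_mem' := by
    rintro a b ⟨s, hs, hsa⟩ ⟨t, ht, htb⟩
    refine ⟨s * t, fun h => (hp.dvd_or_dvd h).elim hs ht, ?_⟩
    rw [mul_smul_mul_comm]
    exact mul_mem hsa htb
  add_mem' := by
    rintro a b ⟨s, hs, hsa⟩ ⟨t, ht, htb⟩
    refine ⟨s * t, fun h => (hp.dvd_or_dvd h).elim hs ht, ?_⟩
    rw [smul_add, mul_comm s t, mul_smul, mul_comm t s, mul_smul]
    exact add_mem (Subalgebra.smul_mem _ hsa t) (Subalgebra.smul_mem _ htb s)
  algebraMap_mem' := fun a => ⟨1, fun h => hp.not_isUnit (isUnit_of_dvd_one h), by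
    rw [one_smul]; exact Subalgebra.algebraMap_mem _ a⟩

lemma adjoin_le_localAdjoin {A L : Type*} [CommRing A] [Field L] [Algebra A L] (y : L) {p : A}
    (hp : Prime p) : Algebra.adjoin A {y} ≤ localAdjoin y hp :=
  fun g hg => ⟨1, fun h => hp.not_isUnit (isUnit_of_dvd_one h), by rwa [one_smul]⟩

lemma aeval_mem_localAdjoin {A L : Type*} [CommRing A] [Field L] [Algebra A L] (y : L) {p : A}
    (hp : Prime p) (f : A[X]) : aeval y f ∈ localAdjoin y hp :=
  adjoin_le_localAdjoin y hp (aeval_mem_adjoin_singleton A y)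

lemma mem_localAdjoin_of_smul_mem {A L : Type*} [CommRing A] [Field L] [Algebra A L] {y : L}
    {p : A} (hp : Prime p) {s : A} (hs : ¬ p ∣ s) {g : L} (hg : s • g ∈ localAdjoin y hp) :
    g ∈ localAdjoin y hp := by
  obtain ⟨t, ht, htg⟩ := hg
  exact ⟨t * s, fun h => (hp.dvd_or_dvd h).elim ht hs, by rwa [mul_smul]⟩

lemma derivation_mem_localAdjoin {K A L : Type*} [CommRing K] [CommRing A] [Field L] [Algebra K L]
    [Algebra A L] {y : L} {p : A} (hp : Prime p) (D : Derivation K L L)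
    (hA : ∀ a : A, D (algebraMap A L a) ∈ localAdjoin y hp) (hy : D y ∈ localAdjoin y hp)
    {g : L} (hg : g ∈ localAdjoin y hp) : D g ∈ localAdjoin y hp := by
  have hadj : ∀ x ∈ Algebra.adjoin A {y}, D x ∈ localAdjoin y hp := fun x hx => by
    induction hx using Algebra.adjoin_induction with
    | mem x hx => rwa [Set.mem_singleton_iff.1 hx]
    | algebraMap a => exact hA a
    | add x z _ _ hx hz => rw [map_add]; exact add_mem hx hz
    | mul x z hx' hz' hx hz =>
      rw [Derivation.leibniz, smul_eq_mul, smul_eq_mul]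
      exact add_mem (mul_mem (adjoin_le_localAdjoin y hp hx') hz)
        (mul_mem (adjoin_le_localAdjoin y hp hz') hx)
  have hg' := hg
  obtain ⟨s, hs, hsg⟩ := hg
  refine mem_localAdjoin_of_smul_mem hp hs ?_
  have h := hadj _ hsg
  rw [Algebra.smul_def, Derivation.leibniz, smul_eq_mul, smul_eq_mul] at h
  have := sub_mem h (mul_mem hg' (hA s))
  rwa [add_sub_cancel_right, ← Algebra.smul_def] at this

lemma MvPolynomial.totalDegree_pderiv_lt {σ K : Type*} [Field K] {f : MvPolynomial σ K} {j : σ}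
    (h : MvPolynomial.pderiv j f ≠ 0) : (MvPolynomial.pderiv j f).totalDegree < f.totalDegree := by
  classical
  refine lt_of_lt_of_le (Nat.lt_succ_self _) ?_
  obtain ⟨m, hm, hmd⟩ : ∃ m ∈ (MvPolynomial.pderiv j f).support,
      (MvPolynomial.pderiv j f).totalDegree = m.sum fun _ e => e :=
    Finset.exists_mem_eq_sup _ (MvPolynomial.support_nonempty.2 h) _
  rw [MvPolynomial.mem_support_iff, MvPolynomial.coeff_pderiv] at hm
  have := MvPolynomial.le_totalDegree (p := f) (s := m + Finsupp.single j 1)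
    (MvPolynomial.mem_support_iff.2 fun h0 => hm (by rw [h0]; simp))
  rw [Finsupp.sum_add_index' (fun _ => rfl) (fun _ _ _ => rfl),
    Finsupp.sum_single_index rfl] at this
  omega

lemma Irreducible.exists_not_dvd_pderiv {σ K : Type*} [Field K] [CharZero K]
    {p : MvPolynomial σ K} (hp : Irreducible p) : ∃ j, ¬ p ∣ MvPolynomial.pderiv j p := by
  classical
  by_contra! h
  have h0 : ∀ j, MvPolynomial.pderiv j p = 0 := fun j => by
    by_contra hj
    obtain ⟨w, hw⟩ := h j
    have hw0 : w ≠ 0 := fun h0 => hj (by rw [hw, h0, mul_zero])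
    have h1 := MvPolynomial.totalDegree_pderiv_lt hj
    rw [hw, MvPolynomial.totalDegree_mul_eq hp.ne_zero hw0] at h1
    omega
  have h2 : p = MvPolynomial.C (p.coeff 0) := by
    ext m
    rw [MvPolynomial.coeff_C]
    split_ifs with hm
    · rw [hm]
    · obtain ⟨j, hj⟩ : ∃ j, m j ≠ 0 := by
        by_contra! hall
        exact hm (Finsupp.ext fun j => (hall j).symm)
      have h3 := MvPolynomial.coeff_pderiv (i := j) p (m - Finsupp.single j 1)
      rw [h0 j, MvPolynomial.coeff_zero, tsub_add_cancel_of_le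
        (Finsupp.single_le_iff.2 (Nat.one_le_iff_ne_zero.2 hj))] at h3
      exact (mul_eq_zero.1 h3.symm).resolve_right (Nat.cast_add_one_ne_zero _)
  refine hp.not_isUnit ?_
  rw [h2]
  refine (isUnit_iff_ne_zero.2 fun h3 => hp.ne_zero ?_).map MvPolynomial.C
  rw [h2, h3, MvPolynomial.C_0]

lemma exists_local_forms {n : ℕ} {K κ E L : Type*} [Field K] [CharZero K] [Field κ] [Field E]
    [Field L] [Algebra κ E] [FiniteDimensional κ E] [Algebra K L]
    [Algebra (MvPolynomial (Fin (n + 1)) K) L] [FaithfulSMul (MvPolynomial (Fin (n + 1)) K) L]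
    (π : MvPolynomial (Fin (n + 1)) K →+* κ) (hfrac : ∀ z, ∃ a b, π b ≠ 0 ∧ z = π a / π b)
    {p : MvPolynomial (Fin (n + 1)) K} (hp : Prime p) (hker : RingHom.ker π = Ideal.span {p})
    {y : L} (hyint : IsIntegral (MvPolynomial (Fin (n + 1)) K) y) {c : ℕ}
    (hc : ∀ i < (minpoly (MvPolynomial (Fin (n + 1)) K) y).natDegree,
      ((minpoly (MvPolynomial (Fin (n + 1)) K) y).coeff i).totalDegree ≤
        c * ((minpoly (MvPolynomial (Fin (n + 1)) K) y).natDegree - i))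
    (hsep : ((minpoly (MvPolynomial (Fin (n + 1)) K) y).map π).Separable)
    (hF'0 : aeval y (derivative (minpoly (MvPolynomial (Fin (n + 1)) K) y)) ≠ 0)
    (hinv : (aeval y (derivative (minpoly (MvPolynomial (Fin (n + 1)) K) y)))⁻¹ ∈
      localAdjoin y hp)
    (pb : PowerBasis κ E)
    (hpb : eval₂ ((algebraMap κ E).comp π) pb.gen (minpoly (MvPolynomial (Fin (n + 1)) K) y) = 0)
    (D : Fin (n + 1) → Derivation K L L)
    (hDA : ∀ j a, D j (algebraMap (MvPolynomial (Fin (n + 1)) K) L a) =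
      algebraMap _ L (MvPolynomial.pderiv j a))
    (hcomm : ∀ i j z, D i (D j z) = D j (D i z)) (hDy : ∀ j, D j y ∈ localAdjoin y hp)
    {a : Fin (n + 1) → L} (ha : ∀ j, a j ∈ localAdjoin y hp)
    {t : MvPolynomial (Fin (n + 1)) K} (ht : ¬ p ∣ t) {h : (MvPolynomial (Fin (n + 1)) K)[X]}
    (hth : t • ∑ j, a j * algebraMap _ L (MvPolynomial.pderiv j p) = aeval y h)
    (hh : eval₂ ((algebraMap κ E).comp π) pb.gen h = 0) :
    ∃ η : Fin (n + 1) → L,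
      (∀ j, ∃ q : ℕ → MvPolynomial (Fin (n + 1)) K,
        (∀ k, (q k).totalDegree ≤ p.totalDegree + c * k) ∧
        aeval y (derivative (minpoly (MvPolynomial (Fin (n + 1)) K) y)) * algebraMap _ L p * η j =
          ∑ k ∈ Finset.range ((minpoly (MvPolynomial (Fin (n + 1)) K) y).natDegree + 1),
            algebraMap _ L (q k) *
              aeval y (divX^[k + 1] (minpoly (MvPolynomial (Fin (n + 1)) K) y))) ∧
      (∀ i j, D i (η j) - D j (η i) ∈ localAdjoin y hp) ∧
      ∑ j, a j * η j ∈ localAdjoin y hp ∧ ∃ j, η j ∉ localAdjoin y hp := by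
  set F := minpoly (MvPolynomial (Fin (n + 1)) K) y with hFdef
  have hF : F.Monic := minpoly.monic hyint
  have hFy : aeval y F = 0 := minpoly.aeval _ _
  have : CharZero κ := charZero_of_injective_ringHom (π.comp MvPolynomial.C).injective
  have hπ : ∀ x, π x = 0 ↔ p ∣ x := fun x => by
    rw [← RingHom.mem_ker, hker, Ideal.mem_span_singleton]
  obtain ⟨s, f, hs, hf0, hf2, hfF, hfg⟩ := exists_idempotent_mod π hfrac pb hF hsep hpb
    (Nat.lt_succ_self F.natDegree)
  have hps : ¬ p ∣ s := fun hd => hs ((hπ s).2 hd)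
  choose q hqdeg hq using fun j k => exists_totalDegree_le_map_eq_mul_trace π hfrac hp.ne_zero hker
    hF hc hpb j k
  have hlift : ∀ h, F.map π ∣ h.map π → ∃ r, aeval y h = algebraMap _ L p * aeval y r :=
    fun h hd => Polynomial.exists_aeval_eq_mul_of_dvd_map π hker hF hFy hd
  have hinj := FaithfulSMul.algebraMap_injective (MvPolynomial (Fin (n + 1)) K) L
  have hp0 : algebraMap (MvPolynomial (Fin (n + 1)) K) L p ≠ 0 :=
    (map_ne_zero_iff _ hinj).2 hp.ne_zero
  have hs0 : algebraMap (MvPolynomial (Fin (n + 1)) K) L s ≠ 0 :=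
    (map_ne_zero_iff _ hinj).2 fun h0 => hps (h0 ▸ dvd_zero p)
  have hsO : ∀ g : (MvPolynomial (Fin (n + 1)) K)[X],
      aeval y g / algebraMap _ L s ∈ localAdjoin y hp := fun g => by
    refine mem_localAdjoin_of_smul_mem hp hps ?_
    rw [Algebra.smul_def, mul_div_cancel₀ _ hs0]
    exact aeval_mem_localAdjoin y hp g
  set F' := aeval y (derivative F) with hF'
  set P := algebraMap (MvPolynomial (Fin (n + 1)) K) L p with hP
  set S := algebraMap (MvPolynomial (Fin (n + 1)) K) L s with hS
  have hDP : ∀ j, D j P = algebraMap _ L (MvPolynomial.pderiv j p) := fun j => hDA j p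
  set e := aeval y f / S with he
  set g : Fin (n + 1) → (MvPolynomial (Fin (n + 1)) K)[X] := fun j =>
    ∑ k ∈ Finset.range (F.natDegree + 1), C (q j k) * divX^[k + 1] F with hg
  have hgy : ∀ j, aeval y (g j) = ∑ k ∈ Finset.range (F.natDegree + 1),
      algebraMap _ L (q j k) * aeval y (divX^[k + 1] F) := fun j => by
    rw [hg, map_sum]
    refine Finset.sum_congr rfl fun k _ => ?_
    rw [map_mul, aeval_C]
  have hgmap : ∀ j, (g j).map π = C (π (MvPolynomial.pderiv j p)) *
      ∑ k ∈ Finset.range (F.natDegree + 1),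
        C (Algebra.trace κ E (pb.gen ^ k)) * divX^[k + 1] (F.map π) := fun j => by
    rw [hg, Polynomial.map_sum, Finset.mul_sum]
    refine Finset.sum_congr rfl fun k _ => ?_
    rw [Polynomial.map_mul, map_C, hq, C_mul, map_divX_iterate, mul_assoc]
  have hηO : ∀ j, aeval y (g j) / (F' * P) - e * D j P / P ∈ localAdjoin y hp := fun j => by
    obtain ⟨r, hr⟩ := hlift _ (hfg _ _ (hgmap j))
    rw [map_sub, map_mul, map_mul, map_mul, aeval_C, aeval_C] at hr
    have : aeval y (g j) / (F' * P) - e * D j P / P = - (F'⁻¹ * (aeval y r / S)) := by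
      rw [hDP, he]
      field_simp
      linear_combination -hr
    rw [this]
    exact neg_mem (mul_mem hinv (hsO r))
  have hDO : ∀ j, ∀ z ∈ (localAdjoin y hp).toSubring, D j z ∈ (localAdjoin y hp).toSubring :=
    fun j z hz => derivation_mem_localAdjoin hp (D j)
      (fun a => by rw [hDA]; exact Subalgebra.algebraMap_mem _ _) (hDy j) hz
  refine ⟨fun j => aeval y (g j) / (F' * P), fun j => ⟨q j, hqdeg j, ?_⟩, ?_, ?_, ?_⟩
  · rw [← hgy]
    field_simp
  · refine fun i j => Subring.derivation_mul_div_sub_mem (localAdjoin y hp).toSubring hp0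
      (Subalgebra.algebraMap_mem _ _) (hsO f) ?_ D hDO hcomm hηO i j
    obtain ⟨r, hr⟩ := hlift _ hf2
    rw [map_sub, map_mul, map_mul, aeval_C] at hr
    have : (e * e - e) / P = aeval y r / S / S := by
      rw [he]
      field_simp
      linear_combination hr
    change (e * e - e) / P ∈ localAdjoin y hp
    rw [this]
    refine mem_localAdjoin_of_smul_mem hp hps ?_
    rw [Algebra.smul_def, mul_div_cancel₀ _ hs0]
    exact hsO r
  · obtain ⟨r, hr⟩ := hlift _ (hf0 h hh)
    rw [map_mul, ← hth] at hr
    have hsum : ∑ j, a j * (aeval y (g j) / (F' * P)) =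
        ∑ j, a j * (aeval y (g j) / (F' * P) - e * D j P / P) +
          e * (∑ j, a j * algebraMap _ L (MvPolynomial.pderiv j p)) / P := by
      rw [Finset.mul_sum, Finset.sum_div, ← Finset.sum_add_distrib]
      refine Finset.sum_congr rfl fun j _ => ?_
      rw [hDP]
      ring
    rw [hsum]
    refine add_mem (sum_mem fun j _ => mul_mem (ha j) (hηO j)) ?_
    refine mem_localAdjoin_of_smul_mem hp ht (mem_localAdjoin_of_smul_mem hp hps ?_)
    have : s • t • (e * (∑ j, a j * algebraMap _ L (MvPolynomial.pderiv j p)) / P) =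
        aeval y r := by
      rw [Algebra.smul_def] at hr
      rw [Algebra.smul_def, Algebra.smul_def, he, ← hS]
      field_simp
      linear_combination hr
    rw [this]
    exact aeval_mem_localAdjoin y hp r
  · by_contra! hall
    obtain ⟨j, hj⟩ := hp.irreducible.exists_not_dvd_pderiv
    have h1 : e / P ∈ localAdjoin y hp := by
      refine mem_localAdjoin_of_smul_mem hp hj ?_
      have := sub_mem (hall j) (hηO j)
      rw [sub_sub_cancel, hP, hDA] at this
      rw [Algebra.smul_def]
      convert this using 1
      ring
    obtain ⟨t', ht', r, hr⟩ : ∃ t', ¬ p ∣ t' ∧ ∃ r : (MvPolynomial (Fin (n + 1)) K)[X],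
        aeval y r = t' • (e / P) := by
      obtain ⟨t', ht', hr⟩ := h1
      rw [Algebra.adjoin_singleton_eq_range_aeval] at hr
      exact ⟨t', ht', hr⟩
    have h2 : F ∣ C t' * f - C (s * p) * r := by
      refine minpoly.isIntegrallyClosed_dvd hyint ?_
      rw [map_sub, map_mul, map_mul, aeval_C, aeval_C, hr, Algebra.smul_def, map_mul, he]
      field_simp
      ring
    have h3 := Polynomial.map_dvd π h2
    rw [Polynomial.map_sub, Polynomial.map_mul, Polynomial.map_mul, map_C, map_C, map_mul,
      (hπ p).2 dvd_rfl, mul_zero, C_0, zero_mul, sub_zero] at h3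
    refine hfF ((IsUnit.dvd_mul_left ?_).1 h3)
    rw [isUnit_C, isUnit_iff_ne_zero]
    exact fun h0 => ht' ((hπ t').1 h0)

end LocalForms

section PoleFamilies

open Polynomial

/-- The `L`-span of the families `i ↦ q i / p i ^ s` such that the numerator has degree at most
`s * deg (p i)`, up to a constant. -/
def poleFamilies {ι σ K : Type*} (L : Type*) [Field K] [Field L] [Algebra (MvPolynomial σ K) L]
    (p : ι → MvPolynomial σ K) (s : ℕ) : Submodule L (ι → L) :=
  Submodule.span L {w | ∃ (N : ℕ) (q : ι → MvPolynomial σ K), ∀ i,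
    (q i).totalDegree ≤ s * (p i).totalDegree + N ∧
    algebraMap _ L (p i) ^ s * w i = algebraMap _ L (q i)}

lemma poleFamilies_le_succ {ι σ K L : Type*} [Field K] [Field L] [Algebra (MvPolynomial σ K) L]
    (p : ι → MvPolynomial σ K) (s : ℕ) : poleFamilies L p s ≤ poleFamilies L p (s + 1) := by
  refine Submodule.span_mono ?_
  rintro w ⟨N, q, hq⟩
  refine ⟨N, fun i => p i * q i, fun i => ⟨?_, ?_⟩⟩
  · have := MvPolynomial.totalDegree_mul (p i) (q i)
    have := (hq i).1
    change (p i * q i).totalDegree ≤ _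
    rw [add_mul]
    omega
  · rw [map_mul, ← (hq i).2]
    ring

lemma derivation_mem_poleFamilies {ι σ K L : Type*} [Field K] [Field L] [Algebra K L]
    [Algebra (MvPolynomial σ K) L] [FaithfulSMul (MvPolynomial σ K) L]
    {p : ι → MvPolynomial σ K} (hp : ∀ i, p i ≠ 0) (D : Derivation K L L) {j : σ}
    (hD : ∀ a : MvPolynomial σ K, D (algebraMap _ L a) = algebraMap _ L (MvPolynomial.pderiv j a))
    {s : ℕ} {w : ι → L} (hw : w ∈ poleFamilies L p s) :
    (fun i => D (w i)) ∈ poleFamilies L p (s + 1) := by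
  have hdeg : ∀ a : MvPolynomial σ K, (MvPolynomial.pderiv j a).totalDegree ≤ a.totalDegree :=
    fun a => by
      by_cases h : MvPolynomial.pderiv j a = 0
      · rw [h]; simp
      · exact (MvPolynomial.totalDegree_pderiv_lt h).le
  induction hw using Submodule.span_induction with
  | mem w hw =>
    obtain ⟨N, q, hq⟩ := hw
    refine Submodule.subset_span ⟨N, fun i => p i * MvPolynomial.pderiv j (q i) -
      s • (q i * MvPolynomial.pderiv j (p i)), fun i => ⟨?_, ?_⟩⟩
    · have h0 := (hq i).1
      have h1 := (MvPolynomial.totalDegree_mul (p i) (MvPolynomial.pderiv j (q i))).trans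
        (add_le_add_right (hdeg (q i)) _)
      have h2 := (MvPolynomial.totalDegree_smul_le s (q i * MvPolynomial.pderiv j (p i))).trans
        ((MvPolynomial.totalDegree_mul _ _).trans (add_le_add_right (hdeg (p i)) _))
      refine (MvPolynomial.totalDegree_sub _ _).trans (max_le ?_ ?_)
      · rw [add_mul]; omega
      · rw [add_mul]; omega
    · have hp0 : algebraMap (MvPolynomial σ K) L (p i) ≠ 0 :=
        (map_ne_zero_iff _ (FaithfulSMul.algebraMap_injective _ L)).2 (hp i)
      have h := congrArg D (hq i).2
      rw [Derivation.leibniz, Derivation.leibniz_pow, hD, hD] at h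
      rw [map_sub, map_mul, map_nsmul, map_mul, ← (hq i).2, ← h]
      simp only [smul_eq_mul, nsmul_eq_mul]
      rcases s with _ | s
      · simp
      · rw [Nat.add_sub_cancel]
        ring
  | zero => 
    have : (fun i => D ((0 : ι → L) i)) = 0 := by ext i; simp
    rw [this]
    exact Submodule.zero_mem _
  | add v w _ _ hv hw => 
    have : (fun i => D ((v + w) i)) = (fun i => D (v i)) + fun i => D (w i) := by ext i; simp
    rw [this]
    exact Submodule.add_mem _ hv hw
  | smul c w hw' hw =>
    have : (fun i => D ((c • w) i)) = c • (fun i => D (w i)) + D c • w := by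
      ext i
      simp [mul_comm]
    rw [this]
    exact add_mem (Submodule.smul_mem _ _ hw)
      (Submodule.smul_mem _ _ (poleFamilies_le_succ p s hw'))

lemma exists_degree_lt_minpoly_of_mem_adjoin {A L : Type*} [CommRing A] [CommRing L] [Algebra A L]
    [Nontrivial A] {y g : L} (hy : IsIntegral A y) (hg : g ∈ Algebra.adjoin A {y}) :
    ∃ B : A[X], B.degree < (minpoly A y).degree ∧ g = aeval y B := by
  rw [Algebra.adjoin_singleton_eq_range_aeval] at hg
  obtain ⟨B, rfl⟩ := hg
  refine ⟨B %ₘ minpoly A y, degree_modByMonic_lt _ (minpoly.monic hy), ?_⟩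
  rw [aeval_modByMonic_eq_self_of_root (minpoly.aeval A y)]
  rfl

lemma Polynomial.degree_C_mul_lt {A : Type*} [CommRing A] {f : A[X]} (a : A) {n : WithBot ℕ}
    (h : f.degree < n) : (C a * f).degree < n := by
  rw [← smul_eq_C_mul]
  exact (degree_smul_le a f).trans_lt h

lemma MvPolynomial.totalDegree_pow_eq {σ K : Type*} [Field K] {f : MvPolynomial σ K} (hf : f ≠ 0)
    (s : ℕ) : (f ^ s).totalDegree = s * f.totalDegree := by
  induction s with
  | zero => simp
  | succ s ih => rw [pow_succ, MvPolynomial.totalDegree_mul_eq (pow_ne_zero s hf) hf, ih, add_mul,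
      one_mul]

lemma exists_aeval_of_mem_poleFamilies {ι σ K L : Type*} [Field K] [Field L]
    [Algebra (MvPolynomial σ K) L] [FaithfulSMul (MvPolynomial σ K) L] {y : L}
    (hy : IsIntegral (MvPolynomial σ K) y)
    (hgen : ∀ g : L, ∃ h : MvPolynomial σ K, h ≠ 0 ∧ h • g ∈ Algebra.adjoin (MvPolynomial σ K) {y})
    {p : ι → MvPolynomial σ K} {s : ℕ} {w : ι → L} (hw : w ∈ poleFamilies L p s) :
    ∃ (h : MvPolynomial σ K) (N : ℕ) (Q : ι → (MvPolynomial σ K)[X]), h ≠ 0 ∧ ∀ i,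
      (Q i).degree < (minpoly (MvPolynomial σ K) y).degree ∧
      (∀ k, ((Q i).coeff k).totalDegree ≤ s * (p i).totalDegree + N) ∧
      (h * p i ^ s) • w i = aeval y (Q i) := by
  have hF : (minpoly (MvPolynomial σ K) y).Monic := minpoly.monic hy
  induction hw using Submodule.closure_induction with
  | zero =>
    refine ⟨1, 0, 0, one_ne_zero, fun i => ⟨?_, by simp, by simp⟩⟩
    simpa [bot_lt_iff_ne_bot, degree_eq_bot] using hF.ne_zero
  | add v w _ _ hv hw =>
    obtain ⟨h, N, Q, h0, hQ⟩ := hv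
    obtain ⟨h', N', Q', h0', hQ'⟩ := hw
    refine ⟨h * h', max (h'.totalDegree + N) (h.totalDegree + N'),
      fun i => C h' * Q i + C h * Q' i, mul_ne_zero h0 h0', fun i => ⟨?_, fun k => ?_, ?_⟩⟩
    · refine (degree_add_le _ _).trans_lt (max_lt ?_ ?_)
      · exact degree_C_mul_lt _ (hQ i).1
      · exact degree_C_mul_lt _ (hQ' i).1
    · rw [coeff_add, coeff_C_mul, coeff_C_mul]
      have h1 := MvPolynomial.totalDegree_mul h' ((Q i).coeff k)
      have h2 := MvPolynomial.totalDegree_mul h ((Q' i).coeff k)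
      have h3 := (hQ i).2.1 k
      have h4 := (hQ' i).2.1 k
      refine (MvPolynomial.totalDegree_add _ _).trans ?_
      omega
    · rw [map_add, map_mul, map_mul, aeval_C, aeval_C, ← (hQ i).2.2, ← (hQ' i).2.2]
      simp only [Algebra.smul_def, Pi.add_apply, map_mul]
      ring
  | smul_mem c w hw =>
    obtain ⟨N, q, hq⟩ := hw
    obtain ⟨h, h0, hc⟩ := hgen c
    obtain ⟨B, hBd, hB⟩ := exists_degree_lt_minpoly_of_mem_adjoin hy hc
    refine ⟨h, N + B.support.sup fun k => (B.coeff k).totalDegree, fun i => C (q i) * B, h0,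
      fun i => ⟨?_, fun k => ?_, ?_⟩⟩
    · exact degree_C_mul_lt _ hBd
    · rw [coeff_C_mul]
      have h1 := MvPolynomial.totalDegree_mul (q i) (B.coeff k)
      have h2 := (hq i).1
      have h3 : (B.coeff k).totalDegree ≤ B.support.sup fun k => (B.coeff k).totalDegree := by
        by_cases hk : B.coeff k = 0
        · rw [hk]; simp
        · exact Finset.le_sup (f := fun k => (B.coeff k).totalDegree) (mem_support_iff.2 hk)
      omega
    · rw [map_mul, aeval_C, ← hB, ← (hq i).2]
      simp only [Algebra.smul_def, Pi.smul_apply, map_mul, map_pow, Algebra.algebraMap_self_apply]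
      ring

lemma exists_fg_of_mem_poleFamilies {ι σ K L : Type*} [Finite σ] [Field K] [Field L] [Algebra K L]
    [Algebra (MvPolynomial σ K) L] [IsScalarTower K (MvPolynomial σ K) L]
    [FaithfulSMul (MvPolynomial σ K) L] {y : L} (hy : IsIntegral (MvPolynomial σ K) y)
    (hgen : ∀ g : L, ∃ h : MvPolynomial σ K, h ≠ 0 ∧ h • g ∈ Algebra.adjoin (MvPolynomial σ K) {y})
    {p : ι → MvPolynomial σ K} (hp : ∀ i, Prime (p i))
    (hcof : ∀ h : MvPolynomial σ K, h ≠ 0 → ∀ᶠ i in Filter.cofinite, ¬ p i ∣ h)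
    {s : ℕ} {w : ι → L} (hw : w ∈ poleFamilies L p s)
    (hwO : ∀ᶠ i in Filter.cofinite, w i ∈ localAdjoin y (hp i)) :
    ∃ V : Submodule K L, V.FG ∧ ∀ᶠ i in Filter.cofinite, w i ∈ V := by
  have hF : (minpoly (MvPolynomial σ K) y).Monic := minpoly.monic hy
  have hinj := FaithfulSMul.algebraMap_injective (MvPolynomial σ K) L
  obtain ⟨h, N, Q, h0, hQ⟩ := exists_aeval_of_mem_poleFamilies hy hgen hw
  have hh0 : algebraMap (MvPolynomial σ K) L h ≠ 0 := (map_ne_zero_iff _ hinj).2 h0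
  set d := (minpoly (MvPolynomial σ K) y).natDegree with hd
  let φ : ℕ → MvPolynomial σ K →ₗ[K] L := fun k =>
    LinearMap.mulRight K (y ^ k / algebraMap _ L h) ∘ₗ
      (Algebra.linearMap (MvPolynomial σ K) L).restrictScalars K
  refine ⟨⨆ k ∈ Finset.range d, (MvPolynomial.restrictTotalDegree σ K N).map (φ k),
    Submodule.fg_biSup _ _ fun k _ => ?_, ?_⟩
  · exact (Module.Finite.iff_fg.1 inferInstance).map _
  · filter_upwards [hwO, hcof h h0] with i hi hph
    obtain ⟨t, ht, hB⟩ := hi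
    obtain ⟨B, hBd, hB⟩ := exists_degree_lt_minpoly_of_mem_adjoin hy hB
    have heq : C (h * p i ^ s) * B = C t * Q i := by
      refine sub_eq_zero.1 (eq_zero_of_dvd_of_degree_lt
        (minpoly.isIntegrallyClosed_dvd hy ?_) ?_)
      · rw [map_sub, map_mul (aeval y), map_mul (aeval y), aeval_C, aeval_C, ← hB, ← (hQ i).2.2]
        simp only [Algebra.smul_def]
        ring
      · exact (degree_sub_le _ _).trans_lt (max_lt (degree_C_mul_lt _ hBd)
          (degree_C_mul_lt _ (hQ i).1))
    have hdvd : ∀ k, p i ^ s ∣ (Q i).coeff k := fun k => by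
      refine (hp i).pow_dvd_of_dvd_mul_left s ht ?_
      have := congrArg (fun f => coeff f k) heq
      simp only [coeff_C_mul] at this
      rw [← this]
      exact ⟨h * B.coeff k, by ring⟩
    choose q hq using hdvd
    have hqdeg : ∀ k, (q k).totalDegree ≤ N := fun k => by
      by_cases hk : q k = 0
      · rw [hk]; simp
      have h1 := (hQ i).2.1 k
      rw [hq, MvPolynomial.totalDegree_mul_eq (pow_ne_zero _ (hp i).ne_zero) hk,
        MvPolynomial.totalDegree_pow_eq (hp i).ne_zero] at h1
      omega
    have hwi : w i = ∑ k ∈ Finset.range d, φ k (q k) := by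
      have h1 := (hQ i).2.2
      have h2 : (Q i).natDegree < d := by
        by_cases h0 : Q i = 0
        · rw [h0, natDegree_zero]; exact minpoly.natDegree_pos hy
        · exact natDegree_lt_natDegree h0 (hQ i).1
      rw [aeval_eq_sum_range' h2] at h1
      simp only [hq, Algebra.smul_def, map_mul, map_pow] at h1
      have hp0 : algebraMap (MvPolynomial σ K) L (p i) ≠ 0 :=
        (map_ne_zero_iff _ hinj).2 (hp i).ne_zero
      have h3 : algebraMap (MvPolynomial σ K) L (p i) ^ s * (algebraMap _ L h * w i -
          ∑ k ∈ Finset.range d, algebraMap _ L (q k) * y ^ k) = 0 := by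
        rw [mul_sub, Finset.mul_sum]
        simp only [mul_assoc] at h1 ⊢
        rw [← h1]
        ring
      have h4 := sub_eq_zero.1 ((mul_eq_zero.1 h3).resolve_left (pow_ne_zero _ hp0))
      rw [eq_comm, ← mul_right_inj' hh0, h4, Finset.mul_sum]
      refine Finset.sum_congr rfl fun k _ => ?_
      change algebraMap _ L h * (algebraMap _ L (q k) * (y ^ k / algebraMap _ L h)) = _
      field_simp
    rw [hwi]
    refine Submodule.sum_mem _ fun k hk => ?_
    exact Submodule.mem_iSup_of_mem k (Submodule.mem_iSup_of_mem hk
      (Submodule.mem_map_of_mem ((MvPolynomial.mem_restrictTotalDegree _ _ _).2 (hqdeg k))))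

end PoleFamilies

section LinearODE

lemma linearIndependent_of_derivation_eq_sum {K L J : Type*} [Fintype J] [Field K] [Field L]
    [Algebra K L] (δ : Derivation K L L) (hδ : ∀ z, δ z = 0 → z ∈ (algebraMap K L).range)
    (M : J → J → L) {n : ℕ} (v : Fin n → J → L) (hv : ∀ m j, δ (v m j) = ∑ i, M j i * v m i)
    (hlin : LinearIndependent K v) : LinearIndependent L v := by
  induction n with
  | zero => exact linearIndependent_empty_type
  | succ n ih =>
    rw [linearIndependent_finSucc] at hlin ⊢
    have hL := ih _ (fun m => hv m.succ) hlin.1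
    refine ⟨hL, fun hspan => hlin.2 ?_⟩
    obtain ⟨c, hc⟩ := (Submodule.mem_span_range_iff_exists_fun L).1 hspan
    have hcj : ∀ j, v 0 j = ∑ m, c m * v (Fin.succ m) j := fun j => by
      rw [← hc, Finset.sum_apply]
      rfl
    have hder : ∑ m, δ (c m) • Fin.tail v m = 0 := by
      ext j
      rw [Finset.sum_apply]
      change ∑ m, δ (c m) * v (Fin.succ m) j = 0
      have h1 := congrArg δ (hcj j)
      rw [hv, map_sum] at h1
      simp only [Derivation.leibniz, smul_eq_mul, hv, Finset.sum_add_distrib] at h1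
      have h2 : ∑ i, M j i * v 0 i = ∑ m, c m * ∑ i, M j i * v (Fin.succ m) i := by
        simp only [hcj, Finset.mul_sum]
        rw [Finset.sum_comm]
        exact Finset.sum_congr rfl fun m _ => Finset.sum_congr rfl fun i _ => by ring
      rw [h2, left_eq_add] at h1
      rw [← h1]
      exact Finset.sum_congr rfl fun m _ => mul_comm _ _
    have hc0 := Fintype.linearIndependent_iff.1 hL _ hder
    choose k hk using fun m => hδ _ (hc0 m)
    refine (Submodule.mem_span_range_iff_exists_fun K).2 ⟨k, ?_⟩
    rw [← hc]
    refine Finset.sum_congr rfl fun m _ => ?_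
    rw [← hk, algebraMap_smul]

lemma fg_of_derivation_eq_sum {K L J : Type*} [Fintype J] [Field K] [Field L]
    [Algebra K L] (δ : Derivation K L L) (hδ : ∀ z, δ z = 0 → z ∈ (algebraMap K L).range)
    (M : J → J → L) (W : Submodule K (J → L)) (hW : ∀ w ∈ W, ∀ j, δ (w j) = ∑ i, M j i * w i) :
    W.FG := by
  rw [← Module.Finite.iff_fg, ← Module.rank_lt_aleph0_iff]
  refine (rank_le (n := Fintype.card J) fun s hs => ?_).trans_lt Cardinal.natCast_lt_aleph0
  have h1 : LinearIndependent K fun m : Fin s.card => (((s.equivFin.symm m : s) : W) : J → L) :=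
    (hs.map' W.subtype (Submodule.ker_subtype W)).comp _ s.equivFin.symm.injective
  have h2 := linearIndependent_of_derivation_eq_sum δ hδ M _
    (fun m => hW _ (s.equivFin.symm m : W).2) h1
  simpa using h2.fintype_card_le_finrank

lemma fg_span_of_closed_forms {K L J ι : Type*} [Fintype J] [Field K] [Field L]
    [Algebra K L] (δ : Derivation K L L) (hδ : ∀ z, δ z = 0 → z ∈ (algebraMap K L).range)
    (D : J → Derivation K L L) (a : J → L) (hD : ∀ z, δ z = ∑ j, a j * D j z)
    {V : Submodule K L} (hV : V.FG) {η : ι → J → L} (h1 : ∀ m, ∑ j, a j * η m j ∈ V)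
    (h2 : ∀ m i j, D i (η m j) - D j (η m i) ∈ V) : (Submodule.span K (Set.range η)).FG := by
  let T : (J → L) →ₗ[K] (Option (J × J) → L) := LinearMap.pi fun o => match o with
    | none => ∑ j, LinearMap.mulLeft K (a j) ∘ₗ LinearMap.proj j
    | some (i, j) => (D i).toLinearMap ∘ₗ LinearMap.proj j - (D j).toLinearMap ∘ₗ LinearMap.proj i
  have hT0 : ∀ w, T w none = ∑ j, a j * w j := fun w => by simp [T]
  have hT1 : ∀ w i j, T w (some (i, j)) = D i (w j) - D j (w i) := fun w i j => by simp [T]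
  have : Module.Finite K V := Module.Finite.iff_fg.2 hV
  refine Submodule.fg_of_fg_map_of_fg_inf_ker T ?_ ?_
  · have hle : (Submodule.span K (Set.range η)).map T ≤
        LinearMap.range (V.subtype.compLeft (Option (J × J))) := by
      rw [Submodule.map_span_le]
      rintro _ ⟨m, rfl⟩
      refine ⟨fun o => ⟨T (η m) o, ?_⟩, rfl⟩
      rcases o with _ | ⟨i, j⟩
      · rw [hT0]; exact h1 m
      · rw [hT1]; exact h2 m i j
    have := Submodule.finiteDimensional_of_le hle
    exact Module.Finite.iff_fg.1 this
  · refine fg_of_derivation_eq_sum δ hδ (fun j i => - D j (a i)) _ fun w hw j => ?_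
    have hker : T w = 0 := hw.2
    have hT := fun o => congrFun hker o
    have h3 := congrArg (D j) ((hT0 w).symm.trans (hT none))
    simp only [Pi.zero_apply, map_zero, map_sum, Derivation.leibniz, smul_eq_mul,
      Finset.sum_add_distrib] at h3
    have h4 : ∀ i, D i (w j) = D j (w i) := fun i =>
      sub_eq_zero.1 ((hT1 w i j).symm.trans (hT (some (i, j))))
    rw [hD]
    simp only [h4]
    rw [eq_neg_of_add_eq_zero_left h3, ← Finset.sum_neg_distrib]
    exact Finset.sum_congr rfl fun i _ => by ring

lemma not_fg_span_of_notMem {K M ι : Type*} [Infinite ι] [Field K] [AddCommGroup M] [Module K M]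
    {v : ι → M} {U : ι → Submodule K M} (h : ∀ i, v i ∉ U i) (h' : ∀ i j, i ≠ j → v j ∈ U i) :
    ¬ (Submodule.span K (Set.range v)).FG := by
  intro hfg
  have hlin : LinearIndependent K v := linearIndependent_iff_notMem_span.2 fun i hi => h i <|
    Submodule.span_le.2 (by rintro _ ⟨j, hj, rfl⟩; exact h' i j fun hij => hj.2 hij.symm) hi
  have : Module.Finite K (Submodule.span K (Set.range v)) := Module.Finite.iff_fg.2 hfg
  have := (linearIndependent_span hlin).finite
  exact not_finite ι

end LinearODE

section InvariantPrimes

lemma Derivation.mem_of_mem_minimalPrimes {K R : Type*} [CommRing K] [CommRing R]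
    [IsNoetherianRing R] [Algebra K R] (δ : Derivation K R R) {I P : Ideal R} (hrad : I.IsRadical)
    (hI : ∀ x ∈ I, δ x ∈ I) (hP : P ∈ I.minimalPrimes) {x : R} (hx : x ∈ P) : δ x ∈ P := by
  classical
  have hfin := I.finite_minimalPrimes_of_isNoetherianRing
  have hPp : P.IsPrime := hP.1.1
  have hnot : ¬ (hfin.toFinset.erase P).inf id ≤ P := by
    rw [hPp.inf_le']
    rintro ⟨Q, hQ, hQP⟩
    rw [Finset.mem_erase, Set.Finite.mem_toFinset] at hQ
    exact hQ.1 (le_antisymm hQP (hP.2 hQ.2.1 hQP))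
  obtain ⟨s, hs, hsP⟩ := SetLike.not_le_iff_exists.1 hnot
  have hsx : s * x ∈ I := by
    rw [← hrad.radical, ← Ideal.sInf_minimalPrimes, Submodule.mem_sInf]
    intro Q hQ
    by_cases hQP : Q = P
    · exact hQP ▸ P.mul_mem_left s hx
    · exact Ideal.mul_mem_right x Q
        ((Finset.inf_le (f := id) (Finset.mem_erase.2 ⟨hQP, hfin.mem_toFinset.2 hQ⟩)) hs)
  have h1 : δ (s * x) ∈ P := hP.1.2 (hI _ hsx)
  rw [Derivation.leibniz, smul_eq_mul, smul_eq_mul] at h1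
  exact (hPp.mem_or_mem ((P.add_mem_iff_left (P.mul_mem_right _ hx)).1 h1)).resolve_left hsP

lemma infinite_heightOnePrime_of_isHypersurfaceIdeal {K R : Type*} [CommRing K] [CommRing R]
    [IsNoetherianRing R] [Algebra K R] (δ : Derivation K R R)
    (hinf : {I : Ideal R | IsHypersurfaceIdeal I ∧ ∀ x ∈ I, δ x ∈ I}.Infinite) :
    {P : Ideal R | HeightOnePrime P ∧ ∀ x ∈ P, δ x ∈ P}.Infinite := by
  intro hfin
  refine hinf ((hfin.powerset.image sInf).subset ?_)
  rintro I ⟨⟨hrad, -, hmin⟩, hI⟩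
  exact ⟨I.minimalPrimes, fun P hP => ⟨hmin P hP, fun x hx =>
    δ.mem_of_mem_minimalPrimes hrad hI hP hx⟩, by rw [Ideal.sInf_minimalPrimes, hrad.radical]⟩

lemma HeightOnePrime.exists_comap_eq_span {A R : Type*} [CommRing A] [IsDomain A]
    [UniqueFactorizationMonoid A] [CommRing R] [IsDomain R] [Algebra A R] [FaithfulSMul A R]
    [Algebra.IsIntegral A R] {P : Ideal R} (hP : HeightOnePrime P) :
    ∃ p : A, Prime p ∧ P.comap (algebraMap A R) = Ideal.span {p} := by
  have := hP.1
  obtain ⟨p, hpP, hp⟩ := (Ideal.comap_isPrime (algebraMap A R) P).exists_mem_prime_of_ne_bot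
    (Ideal.IsIntegral.comap_ne_bot A hP.2.1)
  refine ⟨p, hp, ?_⟩
  have hle : Ideal.span {p} ≤ P.comap (algebraMap A R) := by
    rwa [Ideal.span_singleton_le_iff_mem]
  by_contra hne
  have : (Ideal.span {p}).IsPrime := (Ideal.span_singleton_prime hp.ne_zero).2 hp
  obtain ⟨Q, hQP, hQ, hQp⟩ := Ideal.exists_ideal_lt_liesOver_of_lt P
    (q := P.under A) (lt_of_le_of_ne hle (Ne.symm hne))
  have h1 := hQp.over
  rw [hP.2.2 Q hQ hQP, Ideal.under, Ideal.comap_bot_of_injective _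
    (FaithfulSMul.algebraMap_injective A R), Ideal.span_singleton_eq_bot] at h1
  exact hp.ne_zero h1

lemma exists_primes_of_infinite_heightOnePrime {A R : Type*} [CommRing A] [IsDomain A]
    [UniqueFactorizationMonoid A] [CommRing R] [IsDomain R] [IsNoetherianRing R] [Algebra A R]
    [FaithfulSMul A R] [Algebra.IsIntegral A R] {S : Set (Ideal R)} (hS : S.Infinite)
    (hS1 : ∀ P ∈ S, HeightOnePrime P) :
    ∃ (T : Set (Ideal A)) (p : T → A) (P : T → Ideal R), T.Infinite ∧ (∀ i, Prime (p i)) ∧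
      (∀ i j, i ≠ j → ¬ Associated (p i) (p j)) ∧ (∀ i, P i ∈ S) ∧
      ∀ i, (P i).comap (algebraMap A R) = Ideal.span {p i} := by
  let T := Ideal.comap (algebraMap A R) '' S
  have hT : ∀ i : T, ∃ P ∈ S, P.comap (algebraMap A R) = i := fun i => i.2
  choose P hPS hPi using hT
  choose p hp hpP using fun i => (hS1 _ (hPS i)).exists_comap_eq_span (A := A)
  refine ⟨T, p, P, fun hfin => hS (hfin.of_finite_fibers _ ?_), hp, fun i j hij hass => hij ?_,
    hPS, hpP⟩
  · rintro _ ⟨Q, hQ, rfl⟩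
    obtain ⟨q, hq, hQq⟩ := (hS1 Q hQ).exists_comap_eq_span (A := A)
    refine (Ideal.finite_minimalPrimes_of_isNoetherianRing R
      (Ideal.span {algebraMap A R q})).subset ?_
    rintro Q' ⟨hQ', hQQ'⟩
    have hqQ' : q ∈ Q'.comap (algebraMap A R) := by
      rw [show Q'.comap (algebraMap A R) = _ from hQQ', hQq]
      exact Ideal.mem_span_singleton_self q
    refine ⟨⟨(hS1 Q' hQ').1, (Ideal.span_singleton_le_iff_mem _).2 hqQ'⟩, ?_⟩
    rintro Q'' ⟨hQ'', hle⟩ hlt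
    by_contra hn
    have h0 := (hS1 Q' hQ').2.2 Q'' hQ'' (lt_of_le_not_ge hlt hn)
    rw [h0, Ideal.span_singleton_le_iff_mem, Ideal.mem_bot,
      FaithfulSMul.algebraMap_eq_zero_iff] at hle
    exact hq.ne_zero hle
  · rw [Subtype.ext_iff, ← hPi i, ← hPi j, hpP, hpP]
    exact Ideal.span_singleton_eq_span_singleton.2 hass

lemma eventually_not_dvd_of_pairwise_not_associated {A ι : Type*} [CommRing A] [IsDomain A]
    [UniqueFactorizationMonoid A] {p : ι → A} (hp : ∀ i, Prime (p i))
    (hpp : ∀ i j, i ≠ j → ¬ Associated (p i) (p j)) {h : A} (hh : h ≠ 0) :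
    ∀ᶠ i in Filter.cofinite, ¬ p i ∣ h := by
  classical
  rw [Filter.eventually_cofinite]
  simp only [not_not]
  refine ((UniqueFactorizationMonoid.factors h).toFinset.finite_toSet.biUnion
    (t := fun q => {i | Associated (p i) q}) fun q _ => Set.Subsingleton.finite ?_).subset ?_
  · intro i hi j hj
    by_contra hij
    exact hpp i j hij (hi.trans hj.symm)
  · intro i hi
    obtain ⟨q, hq, hiq⟩ :=
      UniqueFactorizationMonoid.exists_mem_factors_of_dvd hh (hp i).irreducible hi
    exact Set.mem_biUnion (by simpa using hq) hiq

end InvariantPrimes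

section GenericData

open Polynomial

lemma exists_primitive_element_of_finite (A : Type*) {R L : Type*} [CommRing A] [IsDomain A]
    [CharZero A] [CommRing R] [IsDomain R] [Algebra A R] [FaithfulSMul A R] [Module.Finite A R]
    [Field L] [Algebra R L] [IsFractionRing R L] [Algebra A L] [IsScalarTower A R L] :
    ∃ y : R, ∀ g : L, ∃ h : A, h ≠ 0 ∧ h • g ∈ Algebra.adjoin A {algebraMap R L y} := by
  have : FaithfulSMul A L := FaithfulSMul.trans A R L
  let k := FractionRing A
  let _ : Algebra k L := FractionRing.liftAlgebra A L
  have hk0 : ∀ {a : A}, a ≠ 0 → algebraMap A k a ≠ 0 := fun ha =>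
    (map_ne_zero_iff _ (IsFractionRing.injective A k)).2 ha
  have : CharZero k := charZero_of_injective_algebraMap (IsFractionRing.injective A k)
  have : FiniteDimensional k L := by
    have : IsLocalization (Algebra.algebraMapSubmonoid R (nonZeroDivisors A)) L := inferInstance
    exact Module.Finite.of_isLocalization A R (nonZeroDivisors A)
  obtain ⟨α, hα⟩ := Field.exists_primitive_element k L
  obtain ⟨u, v, hv, rfl⟩ := IsFractionRing.div_surjective (A := R) α
  obtain ⟨a, ha, w, hw⟩ := (Algebra.IsAlgebraic.isAlgebraic (R := A) v).exists_nonzero_dvd hv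
  have hv0 : algebraMap R L v ≠ 0 := IsFractionRing.to_map_ne_zero_of_mem_nonZeroDivisors hv
  have hαy : algebraMap R L u / algebraMap R L v =
      algebraMap k L (algebraMap A k a)⁻¹ * algebraMap R L (u * w) := by
    have h1 : algebraMap A L a = algebraMap R L v * algebraMap R L w := by
      rw [IsScalarTower.algebraMap_apply A R L, hw, map_mul]
    have h2 : algebraMap A L a ≠ 0 := by
      rwa [Ne, FaithfulSMul.algebraMap_eq_zero_iff]
    rw [map_inv₀, ← IsScalarTower.algebraMap_apply A k L]
    field_simp
    rw [h1, map_mul]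
    ring
  refine ⟨u * w, fun g => ?_⟩
  have hg : g ∈ Algebra.adjoin k {algebraMap R L (u * w)} := by
    have h1 : g ∈ IntermediateField.adjoin k {algebraMap R L u / algebraMap R L v} := by
      rw [hα]
      trivial
    have hint := (Algebra.IsAlgebraic.isAlgebraic (R := k) (algebraMap R L (u * w)))
    rw [← IntermediateField.adjoin_simple_toSubalgebra_of_isAlgebraic hint]
    refine IntermediateField.adjoin_simple_le_iff.2 ?_ h1
    rw [hαy]
    exact mul_mem (IntermediateField.algebraMap_mem _ _)
      (IntermediateField.mem_adjoin_simple_self k _)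
  induction hg using Algebra.adjoin_induction with
  | mem x hx =>
    refine ⟨1, one_ne_zero, ?_⟩
    rw [one_smul]
    exact Algebra.subset_adjoin hx
  | algebraMap r =>
    obtain ⟨b, c, hc, rfl⟩ := IsFractionRing.div_surjective (A := A) r
    have hc0 := nonZeroDivisors.ne_zero hc
    refine ⟨c, hc0, ?_⟩
    rw [Algebra.smul_def, IsScalarTower.algebraMap_apply A k L c, ← map_mul,
      mul_div_cancel₀ _ (hk0 hc0), ← IsScalarTower.algebraMap_apply A k L]
    exact Subalgebra.algebraMap_mem _ b
  | add x z _ _ hx hz =>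
    obtain ⟨h, h0, hx⟩ := hx
    obtain ⟨h', h0', hz⟩ := hz
    refine ⟨h * h', mul_ne_zero h0 h0', ?_⟩
    rw [smul_add, mul_comm h, mul_smul, mul_comm h', mul_smul h h']
    exact add_mem (Subalgebra.smul_mem _ hx _) (Subalgebra.smul_mem _ hz _)
  | mul x z _ _ hx hz =>
    obtain ⟨h, h0, hx⟩ := hx
    obtain ⟨h', h0', hz⟩ := hz
    refine ⟨h * h', mul_ne_zero h0 h0', ?_⟩
    rw [← smul_mul_smul_comm]
    exact mul_mem hx hz

lemma minpoly.aeval_derivative_ne_zero_of_isIntegral {A L : Type*} [CommRing A] [IsDomain A]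
    [IsIntegrallyClosed A] [CharZero A] [Field L] [Algebra A L] [FaithfulSMul A L] {y : L}
    (hy : IsIntegral A y) : Polynomial.aeval y (derivative (minpoly A y)) ≠ 0 := by
  intro h0
  have hdvd := minpoly.isIntegrallyClosed_dvd hy h0
  have hpos := minpoly.natDegree_pos hy
  have hne : derivative (minpoly A y) ≠ 0 := fun h =>
    hpos.ne' (derivative_eq_zero.1 h)
  exact absurd (natDegree_le_of_dvd hdvd hne) (not_le.2 (natDegree_derivative_lt hpos.ne'))

lemma minpoly.exists_bezout_derivative {A L : Type*} [CommRing A] [IsDomain A]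
    [IsIntegrallyClosed A] [CharZero A] [Field L] [Algebra A L] [FaithfulSMul A L] {y : L}
    (hy : IsIntegral A y) (hgen : ∀ g : L, ∃ h : A, h ≠ 0 ∧ h • g ∈ Algebra.adjoin A {y}) :
    ∃ (h : A) (U V : A[X]), h ≠ 0 ∧
      U * minpoly A y + V * derivative (minpoly A y) = C h := by
  have hF' := aeval_derivative_ne_zero_of_isIntegral hy
  obtain ⟨h, h0, hh⟩ := hgen (Polynomial.aeval y (derivative (minpoly A y)))⁻¹
  rw [Algebra.adjoin_singleton_eq_range_aeval] at hh
  obtain ⟨V, hV⟩ := hh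
  have h1 : Polynomial.aeval y (C h - V * derivative (minpoly A y)) = 0 := by
    rw [map_sub, map_mul, Polynomial.aeval_C]
    change _ - (Polynomial.aeval y).toRingHom V * _ = 0
    rw [show (Polynomial.aeval y).toRingHom V = _ from hV, Algebra.smul_def, mul_assoc,
      inv_mul_cancel₀ hF',
      mul_one, sub_self]
  obtain ⟨U, hU⟩ := minpoly.isIntegrallyClosed_dvd hy h1
  exact ⟨h, U, V, h0, by rw [mul_comm U, ← hU, sub_add_cancel]⟩

lemma exists_totalDegree_coeff_le {σ K : Type*} [CommRing K] (F : (MvPolynomial σ K)[X]) :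
    ∃ c : ℕ, ∀ i < F.natDegree, (F.coeff i).totalDegree ≤ c * (F.natDegree - i) := by
  refine ⟨(Finset.range F.natDegree).sup fun i => (F.coeff i).totalDegree, fun i hi => ?_⟩
  exact (Finset.le_sup (f := fun i => (F.coeff i).totalDegree) (Finset.mem_range.2 hi)).trans
    (Nat.le_mul_of_pos_right _ (Nat.sub_pos_of_lt hi))

lemma exists_powerBasis_residueField.{u, v} {A : Type u} {R : Type v} [CommRing A]
    [CommRing R] [Algebra A R]
    (P : Ideal R) [P.IsPrime] {p : A} (hP : P.comap (algebraMap A R) = Ideal.span {p})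
    {y : R} (hy : IsIntegral A y) :
    ∃ (κ : Type u) (_ : Field κ) (E : Type v) (_ : Field E) (_ : Algebra κ E) (π : A →+* κ)
      (pb : PowerBasis κ E), (∀ z, ∃ a b, π b ≠ 0 ∧ z = π a / π b) ∧
      RingHom.ker π = Ideal.span {p} ∧
      ∀ g : A[X], aeval y g ∈ P → eval₂ ((algebraMap κ E).comp π) pb.gen g = 0 := by
  let Q := P.comap (algebraMap A R)
  let φ : Q.ResidueField →+* P.ResidueField := Ideal.ResidueField.map Q P (algebraMap A R) rfl
  let _ : Algebra Q.ResidueField P.ResidueField := φ.toAlgebra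
  have hφ : (algebraMap Q.ResidueField P.ResidueField).comp (algebraMap A Q.ResidueField) =
      (algebraMap R P.ResidueField).comp (algebraMap A R) :=
    RingHom.ext fun a => Ideal.ResidueField.map_algebraMap Q P (algebraMap A R) rfl a
  have hint : IsIntegral Q.ResidueField (algebraMap R P.ResidueField y) := by
    obtain ⟨F, hF, hFy⟩ := hy
    refine ⟨F.map (algebraMap A Q.ResidueField), hF.map _, ?_⟩
    rw [eval₂_map, hφ, ← hom_eval₂, hFy, map_zero]
  refine ⟨Q.ResidueField, inferInstance,
    IntermediateField.adjoin Q.ResidueField {algebraMap R P.ResidueField y}, inferInstance,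
    inferInstance, algebraMap A Q.ResidueField, IntermediateField.adjoin.powerBasis hint,
    fun z => ?_, by rw [Ideal.ker_algebraMap_residueField]; exact hP, fun g hg => ?_⟩
  · obtain ⟨a, b, hb, rfl⟩ := IsFractionRing.div_surjective (A := A ⧸ Q) z
    obtain ⟨a, rfl⟩ := Ideal.Quotient.mk_surjective a
    obtain ⟨b, rfl⟩ := Ideal.Quotient.mk_surjective b
    exact ⟨a, b, IsFractionRing.to_map_ne_zero_of_mem_nonZeroDivisors (R := A ⧸ Q)
      (K := Q.ResidueField) hb, rfl⟩
  · apply (algebraMap (IntermediateField.adjoin Q.ResidueField {algebraMap R P.ResidueField y})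
      P.ResidueField).injective
    rw [IntermediateField.adjoin.powerBasis_gen, hom_eval₂, ← RingHom.comp_assoc,
      ← IsScalarTower.algebraMap_eq, IntermediateField.AdjoinSimple.algebraMap_gen, map_zero,
      hφ, ← hom_eval₂, Ideal.algebraMap_residueField_eq_zero]
    exact hg

end GenericData

section FirstIntegral

open Polynomial

/-- Closed forms with a single pole along `p i` cannot exist for infinitely many `i` when the
derivation `d` has no constants besides `K`. -/
lemma false_of_infinite_local_forms {σ K L ι : Type*} [Fintype σ] [Infinite ι] [Field K]
    [Field L] [Algebra K L] [Algebra (MvPolynomial σ K) L]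
    [IsScalarTower K (MvPolynomial σ K) L] [FaithfulSMul (MvPolynomial σ K) L] {y : L}
    (hy : IsIntegral (MvPolynomial σ K) y)
    (hgen : ∀ g : L, ∃ h : MvPolynomial σ K, h ≠ 0 ∧ h • g ∈ Algebra.adjoin (MvPolynomial σ K) {y})
    {p : ι → MvPolynomial σ K} (hp : ∀ i, Prime (p i))
    (hcof : ∀ h : MvPolynomial σ K, h ≠ 0 → ∀ᶠ i in Filter.cofinite, ¬ p i ∣ h)
    (hpp : ∀ i j, i ≠ j → ¬ p i ∣ p j)
    (hF'0 : aeval y (derivative (minpoly (MvPolynomial σ K) y)) ≠ 0)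
    (hinv : ∀ i, (aeval y (derivative (minpoly (MvPolynomial σ K) y)))⁻¹ ∈ localAdjoin y (hp i))
    (D : σ → Derivation K L L)
    (hDA : ∀ j a, D j (algebraMap (MvPolynomial σ K) L a) =
      algebraMap _ L (MvPolynomial.pderiv j a))
    (d : Derivation K L L) (hd : ∀ z, d z = 0 → z ∈ (algebraMap K L).range)
    {a : σ → L} (hdD : ∀ z, d z = ∑ j, a j * D j z) {c m : ℕ} {η : ι → σ → L}
    (hη : ∀ i j, ∃ q : ℕ → MvPolynomial σ K,
      (∀ k, (q k).totalDegree ≤ (p i).totalDegree + c * k) ∧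
      aeval y (derivative (minpoly (MvPolynomial σ K) y)) * algebraMap _ L (p i) * η i j =
        ∑ k ∈ Finset.range m,
          algebraMap _ L (q k) * aeval y (divX^[k + 1] (minpoly (MvPolynomial σ K) y)))
    (h1 : ∀ i j k, D j (η i k) - D k (η i j) ∈ localAdjoin y (hp i))
    (h2 : ∀ i, ∑ j, a j * η i j ∈ localAdjoin y (hp i))
    (h3 : ∀ i, ∃ j, η i j ∉ localAdjoin y (hp i)) : False := by
  choose q hqd hq using hη
  set F' := aeval y (derivative (minpoly (MvPolynomial σ K) y))
  set f : ℕ → L := fun k => aeval y (divX^[k + 1] (minpoly (MvPolynomial σ K) y))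
  have hp0 : ∀ i, algebraMap (MvPolynomial σ K) L (p i) ≠ 0 := fun i => by
    rw [Ne, FaithfulSMul.algebraMap_eq_zero_iff]
    exact (hp i).ne_zero
  have hw : ∀ j, (fun i => η i j) ∈ poleFamilies L p 1 := fun j => by
    have : (fun i => η i j) = ∑ k ∈ Finset.range m,
        (f k / F') • fun i => algebraMap _ L (q i j k) / algebraMap _ L (p i) := by
      ext i
      rw [Finset.sum_apply]
      refine mul_left_cancel₀ (mul_ne_zero hF'0 (hp0 i)) ((hq i j).trans ?_)
      rw [Finset.mul_sum]
      refine Finset.sum_congr rfl fun k _ => ?_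
      have := hp0 i
      simp only [Pi.smul_apply, smul_eq_mul, f]
      field_simp
    rw [this]
    refine Submodule.sum_mem _ fun k _ => Submodule.smul_mem _ _ (Submodule.subset_span ?_)
    refine ⟨c * k, fun i => q i j k, fun i => ⟨by simpa using hqd i j k, ?_⟩⟩
    rw [pow_one, mul_div_cancel₀ _ (hp0 i)]
  have hw1 : (fun i => ∑ j, a j * η i j) ∈ poleFamilies L p 1 := by
    have : (fun i => ∑ j, a j * η i j) = ∑ j, a j • fun i => η i j := by
      ext i
      simp
    rw [this]
    exact Submodule.sum_mem _ fun j _ => Submodule.smul_mem _ _ (hw j)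
  have hw2 : ∀ j k, (fun i => D j (η i k) - D k (η i j)) ∈ poleFamilies L p 2 := fun j k =>
    sub_mem (derivation_mem_poleFamilies (fun i => (hp i).ne_zero) (D j) (hDA j) (hw k))
      (derivation_mem_poleFamilies (fun i => (hp i).ne_zero) (D k) (hDA k) (hw j))
  obtain ⟨V₁, hV₁, hV₁w⟩ := exists_fg_of_mem_poleFamilies hy hgen hp hcof hw1
    (Filter.Eventually.of_forall h2)
  choose V₂ hV₂ hV₂w using fun j k => exists_fg_of_mem_poleFamilies hy hgen hp hcof (hw2 j k)
    (Filter.Eventually.of_forall fun i => h1 i j k)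
  let G := {i | ∑ j, a j * η i j ∈ V₁ ∧ ∀ j k, D j (η i k) - D k (η i j) ∈ V₂ j k}
  have hG : ∀ᶠ i in Filter.cofinite, i ∈ G :=
    hV₁w.and (Filter.eventually_all.2 fun j => Filter.eventually_all.2 fun k => hV₂w j k)
  have : Infinite G := (Filter.frequently_cofinite_iff_infinite.1 hG.frequently).to_subtype
  have hfg := fg_span_of_closed_forms d hd D a hdD (V := V₁ ⊔ ⨆ j, ⨆ k, V₂ j k)
    (η := fun i : G => η i)
    (hV₁.sup (Submodule.fg_iSup _ fun j => Submodule.fg_iSup _ fun k => hV₂ j k))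
    (fun i => Submodule.mem_sup_left i.2.1)
    (fun i j k => Submodule.mem_sup_right
      (Submodule.mem_iSup_of_mem j (Submodule.mem_iSup_of_mem k (i.2.2 j k))))
  refine not_fg_span_of_notMem (U := fun i : G => Submodule.pi Set.univ fun _ =>
    (Subalgebra.toSubmodule (localAdjoin y (hp i))).restrictScalars K) ?_ ?_ hfg
  · intro i hi
    obtain ⟨j, hj⟩ := h3 i
    exact hj (hi j trivial)
  · intro i i' hii' j _
    refine mem_localAdjoin_of_smul_mem (hp i) (hpp i i' (Subtype.coe_ne_coe.2 hii')) ?_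
    have h4 : p i' • η i' j = F'⁻¹ * ∑ k ∈ Finset.range m, algebraMap _ L (q i' j k) * f k := by
      rw [← hq, Algebra.smul_def, mul_assoc, inv_mul_cancel_left₀ hF'0]
    rw [h4]
    exact mul_mem (hinv i) (sum_mem fun k _ => mul_mem (Subalgebra.algebraMap_mem _ _)
      (aeval_mem_localAdjoin y (hp i) _))

lemma exists_local_forms_of_derivation_mem {n : ℕ} {K R L : Type*} [Field K] [CharZero K]
    [CommRing R] [Field L] [Algebra K L] [Algebra (MvPolynomial (Fin (n + 1)) K) R]
    [Algebra R L] [FaithfulSMul R L]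
    [Algebra (MvPolynomial (Fin (n + 1)) K) L] [FaithfulSMul (MvPolynomial (Fin (n + 1)) K) L]
    [IsScalarTower (MvPolynomial (Fin (n + 1)) K) R L] (P : Ideal R) [P.IsPrime]
    {p : MvPolynomial (Fin (n + 1)) K} (hp : Prime p)
    (hP : P.comap (algebraMap (MvPolynomial (Fin (n + 1)) K) R) = Ideal.span {p})
    {y : R} {z : L} (hyz : algebraMap R L y = z)
    (hy : IsIntegral (MvPolynomial (Fin (n + 1)) K) y) {c : ℕ}
    (hc : ∀ i < (minpoly (MvPolynomial (Fin (n + 1)) K) z).natDegree,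
      ((minpoly (MvPolynomial (Fin (n + 1)) K) z).coeff i).totalDegree ≤
        c * ((minpoly (MvPolynomial (Fin (n + 1)) K) z).natDegree - i))
    {h : MvPolynomial (Fin (n + 1)) K} {U V : (MvPolynomial (Fin (n + 1)) K)[X]}
    (hUV : U * minpoly (MvPolynomial (Fin (n + 1)) K) z +
      V * derivative (minpoly (MvPolynomial (Fin (n + 1)) K) z) = C h) (hph : ¬ p ∣ h)
    (hF'0 : aeval z (derivative (minpoly (MvPolynomial (Fin (n + 1)) K) z)) ≠ 0)
    (hinv : (aeval z (derivative (minpoly (MvPolynomial (Fin (n + 1)) K) z)))⁻¹ ∈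
      localAdjoin z hp)
    (D : Fin (n + 1) → Derivation K L L)
    (hDA : ∀ j a, D j (algebraMap (MvPolynomial (Fin (n + 1)) K) L a) =
      algebraMap _ L (MvPolynomial.pderiv j a))
    (hcomm : ∀ i j z, D i (D j z) = D j (D i z)) (hDz : ∀ j, D j z ∈ localAdjoin z hp)
    {a : Fin (n + 1) → L} (ha : ∀ j, a j ∈ localAdjoin z hp) {r : R} (hr : r ∈ P)
    (har : ∑ j, a j * algebraMap _ L (MvPolynomial.pderiv j p) = algebraMap R L r) :
    ∃ η : Fin (n + 1) → L,
      (∀ j, ∃ q : ℕ → MvPolynomial (Fin (n + 1)) K,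
        (∀ k, (q k).totalDegree ≤ p.totalDegree + c * k) ∧
        aeval z (derivative (minpoly (MvPolynomial (Fin (n + 1)) K) z)) * algebraMap _ L p * η j =
          ∑ k ∈ Finset.range ((minpoly (MvPolynomial (Fin (n + 1)) K) z).natDegree + 1),
            algebraMap _ L (q k) *
              aeval z (divX^[k + 1] (minpoly (MvPolynomial (Fin (n + 1)) K) z))) ∧
      (∀ i j, D i (η j) - D j (η i) ∈ localAdjoin z hp) ∧
      ∑ j, a j * η j ∈ localAdjoin z hp ∧ ∃ j, η j ∉ localAdjoin z hp := by
  obtain ⟨κ, _, E, _, _, π, pb, hfrac, hker, hev⟩ := exists_powerBasis_residueField P hP hy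
  have : FiniteDimensional κ E := pb.finite
  have haev : ∀ g : (MvPolynomial (Fin (n + 1)) K)[X],
      aeval z g = algebraMap R L (aeval y g) := fun g => by
    rw [← hyz, aeval_algebraMap_apply]
  have hRL := FaithfulSMul.algebraMap_injective R L
  obtain ⟨t, ht, htmem⟩ : ∑ j, a j * algebraMap _ L (MvPolynomial.pderiv j p) ∈
      localAdjoin z hp :=
    sum_mem fun j _ => mul_mem (ha j) (Subalgebra.algebraMap_mem _ _)
  rw [Algebra.adjoin_singleton_eq_range_aeval] at htmem
  obtain ⟨g, hg⟩ := htmem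
  replace hg : aeval z g = _ := hg
  have hgP : aeval y g ∈ P := by
    have : aeval y g = t • r := hRL <| by
      rw [← haev, hg, har, Algebra.smul_def, Algebra.smul_def, map_mul,
        ← IsScalarTower.algebraMap_apply]
    rw [this, Algebra.smul_def]
    exact P.mul_mem_left _ hr
  have hπh : π h ≠ 0 := fun h0 => hph <| by
    rwa [← RingHom.mem_ker, hker, Ideal.mem_span_singleton] at h0
  refine exists_local_forms π hfrac hp hker
    (hyz ▸ hy.map (IsScalarTower.toAlgHom (MvPolynomial (Fin (n + 1)) K) R L)) hc ?_
    hF'0 hinv pb (hev _ ?_) D hDA hcomm hDz ha ht hg.symm (hev _ hgP)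
  · refine ⟨C (π h)⁻¹ * U.map π, C (π h)⁻¹ * V.map π, ?_⟩
    rw [derivative_map, mul_assoc, mul_assoc, ← mul_add, ← Polynomial.map_mul,
      ← Polynomial.map_mul, ← Polynomial.map_add, hUV, map_C, ← C_mul, inv_mul_cancel₀ hπh, C_1]
  · rw [hRL ((haev _).symm.trans ((minpoly.aeval _ z).trans (map_zero _).symm))]
    exact P.zero_mem

lemma exists_notMem_range_of_infinite_heightOnePrime {n : ℕ} {K R L : Type*} [Field K]
    [CharZero K] [CommRing R] [IsDomain R] [Algebra K R] [Field L] [Algebra K L]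
    [Algebra (MvPolynomial (Fin (n + 1)) K) R] [FaithfulSMul (MvPolynomial (Fin (n + 1)) K) R]
    [Module.Finite (MvPolynomial (Fin (n + 1)) K) R] [Algebra R L] [IsFractionRing R L]
    [Algebra (MvPolynomial (Fin (n + 1)) K) L] [IsScalarTower (MvPolynomial (Fin (n + 1)) K) R L]
    [IsScalarTower K (MvPolynomial (Fin (n + 1)) K) L]
    (δ : Derivation K R R)
    (hinf : {P : Ideal R | HeightOnePrime P ∧ ∀ x ∈ P, δ x ∈ P}.Infinite)
    (d : Derivation K L L) (hd : ∀ r, d (algebraMap R L r) = algebraMap R L (δ r)) :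
    ∃ z, d z = 0 ∧ z ∉ (algebraMap K L).range := by
  by_contra! hconst
  have : FaithfulSMul (MvPolynomial (Fin (n + 1)) K) L := FaithfulSMul.trans _ R L
  have : IsNoetherianRing R := IsNoetherianRing.of_finite (MvPolynomial (Fin (n + 1)) K) R
  obtain ⟨T, p, P, hT, hp, hpass, hPS, hPp⟩ :=
    exists_primes_of_infinite_heightOnePrime (A := MvPolynomial (Fin (n + 1)) K) hinf
      fun P hP => hP.1
  have hcof : ∀ h : MvPolynomial (Fin (n + 1)) K, h ≠ 0 → ∀ᶠ i in Filter.cofinite, ¬ p i ∣ h :=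
    fun h hh => eventually_not_dvd_of_pairwise_not_associated hp hpass hh
  obtain ⟨y, hgen⟩ := exists_primitive_element_of_finite (MvPolynomial (Fin (n + 1)) K)
    (R := R) (L := L)
  have hy : IsIntegral (MvPolynomial (Fin (n + 1)) K) y := Algebra.IsIntegral.isIntegral y
  obtain ⟨z, hyz⟩ : ∃ z, algebraMap R L y = z := ⟨_, rfl⟩
  rw [hyz] at hgen
  have hz : IsIntegral (MvPolynomial (Fin (n + 1)) K) z :=
    hyz ▸ hy.map (IsScalarTower.toAlgHom (MvPolynomial (Fin (n + 1)) K) R L)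
  have hO : ∀ g : L, ∀ᶠ i in Filter.cofinite, g ∈ localAdjoin z (hp i) := fun g => by
    obtain ⟨h, h0, hg⟩ := hgen g
    exact (hcof h h0).mono fun i hi => ⟨h, hi, hg⟩
  obtain ⟨c, hc⟩ := exists_totalDegree_coeff_le (minpoly (MvPolynomial (Fin (n + 1)) K) z)
  have hF'0 := minpoly.aeval_derivative_ne_zero_of_isIntegral hz
  obtain ⟨h, U, V, h0, hUV⟩ := minpoly.exists_bezout_derivative hz hgen
  have := formallyEtale_of_isIntegral (A := MvPolynomial (Fin (n + 1)) K) (R := R) (L := L)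
  obtain ⟨D, hDA, hcomm, hdD⟩ := MvPolynomial.exists_extend_pderiv (σ := Fin (n + 1)) (K := K)
    (L := L)
  let a : Fin (n + 1) → L := fun j =>
    d (algebraMap (MvPolynomial (Fin (n + 1)) K) L (MvPolynomial.X j))
  let G := {i | ¬ p i ∣ h ∧
    (aeval z (derivative (minpoly (MvPolynomial (Fin (n + 1)) K) z)))⁻¹ ∈ localAdjoin z (hp i) ∧
    (∀ j, D j z ∈ localAdjoin z (hp i)) ∧ ∀ j, a j ∈ localAdjoin z (hp i)}
  have hG : ∀ᶠ i in Filter.cofinite, i ∈ G := (hcof h h0).and ((hO _).and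
    ((Filter.eventually_all.2 fun j => hO _).and (Filter.eventually_all.2 fun j => hO _)))
  have : Infinite T := hT.to_subtype
  have : Infinite G := (Filter.frequently_cofinite_iff_infinite.1 hG.frequently).to_subtype
  have hforms : ∀ i : G, _ := fun i => by
    have := (hPS i).1.1
    refine exists_local_forms_of_derivation_mem (P i) (hp i) (hPp i) hyz hy hc hUV i.2.1 hF'0
      i.2.2.1 D hDA hcomm i.2.2.2.1 i.2.2.2.2
      (r := δ (algebraMap (MvPolynomial (Fin (n + 1)) K) R (p i))) ((hPS i).2 _ ?_) ?_
    · change _ ∈ (P i).comap _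
      rw [hPp]
      exact Ideal.mem_span_singleton_self _
    · rw [← hd, ← IsScalarTower.algebraMap_apply, hdD]
      exact Finset.sum_congr rfl fun j _ => by rw [hDA]
  choose η hη h1 h2 h3 using hforms
  exact false_of_infinite_local_forms (p := fun i : G => p i) hz hgen (fun i => hp i)
    (fun h hh => Subtype.val_injective.tendsto_cofinite.eventually (hcof h hh))
    (fun i j hij hdvd => hpass i j (Subtype.coe_ne_coe.2 hij)
      ((hp i).associated_of_dvd (hp j) hdvd))
    hF'0 (fun i => i.2.2.1) D hDA d hconst (hdD d) hη h1 h2 h3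

end FirstIntegral

/-- **Jouanolou–Hrushovski.** If an algebraic `D`-variety `(X, s)` over an algebraically
closed field of characteristic zero has infinitely many `D`-subvarieties of pure
codimension one, then there is a nonconstant rational function `g = a/b ∈ K(X)` with
`δ(g) = 0`. -/
theorem jouanolou_hrushovski
    (K : Type*) [Field K] [IsAlgClosed K] [CharZero K]
    (R : Type*) [CommRing R] [IsDomain R] [Algebra K R] [Algebra.FiniteType K R]
    (δ : Derivation K R R)
    (hinf : {I : Ideal R | IsHypersurfaceIdeal I ∧ ∀ x ∈ I, δ x ∈ I}.Infinite) :
    ∃ a b : R, b ≠ 0 ∧ (∀ c : K, a ≠ algebraMap K R c * b) ∧ δ a * b = a * δ b := by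
  have : IsNoetherianRing R := Algebra.FiniteType.isNoetherianRing K R
  have hinf' := infinite_heightOnePrime_of_isHypersurfaceIdeal δ hinf
  obtain ⟨m, g, hg, hgfin⟩ := exists_finite_inj_algHom_of_fg K R
  let _ : Algebra (MvPolynomial (Fin m) K) R := g.toAlgebra
  have : IsScalarTower K (MvPolynomial (Fin m) K) R :=
    .of_algebraMap_eq fun k => (g.commutes k).symm
  have : FaithfulSMul (MvPolynomial (Fin m) K) R := (faithfulSMul_iff_algebraMap_injective _ _).2 hg
  have : Module.Finite (MvPolynomial (Fin m) K) R := hgfin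
  obtain _ | n := m
  · obtain ⟨P, ⟨hP, -⟩⟩ := hinf'.nonempty
    obtain ⟨p, hp, -⟩ := hP.exists_comap_eq_span (A := MvPolynomial (Fin 0) K)
    have hu := (isUnit_iff_ne_zero.2 ((map_ne_zero_iff _
      (MvPolynomial.isEmptyAlgEquiv K (Fin 0)).injective).2 hp.ne_zero))
    exact absurd ((MulEquiv.isUnit_map (MvPolynomial.isEmptyAlgEquiv K (Fin 0))).1 hu) hp.not_isUnit
  have : Algebra.FormallyEtale R (FractionRing R) := .of_isLocalization (nonZeroDivisors R)
  obtain ⟨d, hd⟩ := Derivation.exists_extension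
    ((Algebra.linearMap R (FractionRing R)).compDer δ)
  obtain ⟨z, hz, hzK⟩ := exists_notMem_range_of_infinite_heightOnePrime (n := n) δ hinf' d hd
  obtain ⟨a, b, hb, rfl⟩ := IsFractionRing.div_surjective (A := R) z
  have hb0 := IsFractionRing.to_map_ne_zero_of_mem_nonZeroDivisors (K := FractionRing R) hb
  refine ⟨a, b, nonZeroDivisors.ne_zero hb, fun c hc => hzK ⟨c, ?_⟩, ?_⟩
  · rw [hc, map_mul, mul_div_cancel_right₀ _ hb0, ← IsScalarTower.algebraMap_apply]
  · apply IsFractionRing.injective R (FractionRing R)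
    have h1 := d.leibniz (algebraMap R (FractionRing R) a / algebraMap R (FractionRing R) b)
      (algebraMap R (FractionRing R) b)
    rw [div_mul_cancel₀ _ hb0, hz, smul_zero, add_zero, hd, hd] at h1
    change algebraMap R (FractionRing R) (δ a) = _ * algebraMap R (FractionRing R) (δ b) at h1
    rw [map_mul, map_mul, h1]
    field_simp
end

section
/- Let k be a finitely generated field of characteristic zero and φ : Z → X a dominant rational map between algebraic varieties over k. Then there exist nonempty Zariski open subsets V ⊆ Z and U ⊆ X such that the restriction φ^V : V → U is a dominant regular morphism, and for all but finitely many hypersurfaces H on U, the scheme-theoretic inverse image (φ^V)⁻¹(H) equals the proper transform (φ^V)*H. -/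
/-- The vanishing ideal of the proper transform of `V(I)` along the dominant map induced
by `f`. -/
def properTransform {R S : Type*} [CommRing R] [CommRing S] (f : R →+* S) (I : Ideal R) :
    Ideal S :=
  sInf {Q : Ideal S | Q ∈ (I.map f).minimalPrimes ∧ Q.comap f ∈ I.minimalPrimes}

open scoped TensorProduct Polynomial

lemma Polynomial.natDegree_eq_zero_of_isIntegral {A : Type*} [CommRing A] [IsDomain A] {p : A[X]}
    (hp : IsIntegral A p) : p.natDegree = 0 := by
  obtain ⟨f, hf, h⟩ := hp
  by_contra hd
  have h0 : f.comp p = 0 := h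
  have hn := congrArg Polynomial.natDegree h0
  rw [Polynomial.natDegree_comp, Polynomial.natDegree_zero, mul_eq_zero, or_iff_left hd] at hn
  rw [hf.natDegree_eq_zero.mp hn] at h0
  simp at h0

lemma Polynomial.coeff_eq_zero_of_isIntegral {A : Type*} [CommRing A] [IsReduced A] {p : A[X]}
    (hp : IsIntegral A p) {n : ℕ} (hn : n ≠ 0) : p.coeff n = 0 := by
  refine IsNilpotent.eq_zero ((mem_nilradical).mp ?_)
  rw [nilradical_eq_sInf, Ideal.mem_sInf]
  intro P (hP : P.IsPrime)
  rw [← Ideal.Quotient.eq_zero_iff_mem, ← Polynomial.coeff_map]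
  refine Polynomial.coeff_eq_zero_of_natDegree_lt (lt_of_le_of_lt (le_of_eq ?_) hn.bot_lt)
  refine Polynomial.natDegree_eq_zero_of_isIntegral ?_
  exact hp.map_of_comp_eq (Ideal.Quotient.mk P) (Polynomial.mapRingHom (Ideal.Quotient.mk P))
    (by ext; simp)

/-- A smooth algebra over a reduced ring is reduced. -/
lemma Algebra.Smooth.isReduced (A B : Type*) [CommRing A] [CommRing B] [Algebra A B]
    [IsReduced A] [Algebra.Smooth A B] : IsReduced B := by
  refine ⟨fun b hb ↦ ?_⟩
  let π : B ⊗[A] A[X] →ₗ[A] B :=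
    (_root_.TensorProduct.rid A B).toLinearMap ∘ₗ (Polynomial.lcoeff A 1).lTensor B
  have hnil : IsNilpotent (b ⊗ₜ[A] (Polynomial.X : A[X])) := by
    obtain ⟨n, hn⟩ := hb
    exact ⟨n, by rw [Algebra.TensorProduct.tmul_pow, hn, TensorProduct.zero_tmul]⟩
  have hint : IsIntegral B (b ⊗ₜ[A] (Polynomial.X : A[X])) := by
    obtain ⟨n, hn⟩ := hnil
    exact .of_pow n.succ_pos (by rw [pow_succ, hn, zero_mul]; exact isIntegral_zero)
  obtain ⟨t, ht⟩ := (TensorProduct.toIntegralClosure_bijective_of_smooth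
    (R := A) (S := B) (B := A[X])).surjective ⟨_, hint⟩
  have hπ (t : B ⊗[A] integralClosure A A[X]) :
      π (TensorProduct.toIntegralClosure A B A[X] t) = 0 := by
    induction t with
    | zero => simp
    | add x y hx hy => rw [map_add, Subalgebra.coe_add, map_add, hx, hy, add_zero]
    | tmul x y =>
      change π (x ⊗ₜ[A] (y : A[X])) = 0
      simp [π, Polynomial.coeff_eq_zero_of_isIntegral y.2]
  have := hπ t
  rw [ht] at this
  simpa [π] using this

lemma Ideal.IsRadical.map_of_smooth {A B : Type*} [CommRing A] [CommRing B] [Algebra A B]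
    [Algebra.Smooth A B] {I : Ideal A} (hI : I.IsRadical) :
    (I.map (algebraMap A B)).IsRadical := by
  have : IsReduced (A ⧸ I) := (Ideal.isRadical_iff_quotient_reduced I).mp hI
  rw [Ideal.isRadical_iff_quotient_reduced]
  have e := Algebra.TensorProduct.quotIdealMapEquivTensorQuot B I
  have : IsReduced (B ⊗[A] (A ⧸ I)) :=
    have := Algebra.Smooth.isReduced (A ⧸ I) ((A ⧸ I) ⊗[A] B)
    isReduced_of_injective (Algebra.TensorProduct.comm A B (A ⧸ I))
      (Algebra.TensorProduct.comm A B (A ⧸ I)).injective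
  exact isReduced_of_injective e e.injective

lemma Ideal.comap_mem_minimalPrimes_of_mem_minimalPrimes_map {A B : Type*} [CommRing A]
    [CommRing B] [Algebra A B] [Algebra.HasGoingDown A B] {I : Ideal A} {Q : Ideal B}
    (hQ : Q ∈ (I.map (algebraMap A B)).minimalPrimes) :
    Q.comap (algebraMap A B) ∈ I.minimalPrimes := by
  have hQp : Q.IsPrime := hQ.1.1
  refine ⟨⟨inferInstance, Ideal.map_le_iff_le_comap.mp hQ.1.2⟩, fun P hP hPQ ↦ ?_⟩
  have hPp : P.IsPrime := hP.1
  have : Q.LiesOver (Q.comap (algebraMap A B)) := ⟨rfl⟩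
  obtain ⟨Q', hQ'Q, hQ', hover⟩ := Ideal.exists_ideal_le_liesOver_of_le Q hPQ
  have hle : I.map (algebraMap A B) ≤ Q' :=
    Ideal.map_le_iff_le_comap.mpr (hP.2.trans hover.over.le)
  exact (Ideal.comap_mono (hQ.2 ⟨hQ', hle⟩ hQ'Q)).trans hover.over.ge

lemma Ideal.IsRadical.map_eq_properTransform {A B : Type*} [CommRing A] [CommRing B] {f : A →+* B}
    (hf : f.Smooth) {I : Ideal A} (hI : I.IsRadical) : I.map f = properTransform f I := by
  algebraize [f]
  have hset : {Q : Ideal B | Q ∈ (I.map f).minimalPrimes ∧ Q.comap f ∈ I.minimalPrimes} =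
      (I.map f).minimalPrimes :=
    Set.sep_eq_self_iff_mem_true.mpr fun Q hQ ↦
      Ideal.comap_mem_minimalPrimes_of_mem_minimalPrimes_map hQ
  rw [properTransform, hset, Ideal.sInf_minimalPrimes]
  exact (Ideal.IsRadical.map_of_smooth hI).radical.symm

/-- Generic smoothness in characteristic zero. -/
lemma Algebra.exists_smooth_localizationAway (A B : Type*) [CommRing A] [IsDomain A] [CharZero A]
    [IsNoetherianRing A] [CommRing B] [IsDomain B] [Algebra A B] [Algebra.FiniteType A B]
    (hinj : Function.Injective (algebraMap A B)) :
    ∃ b : B, b ≠ 0 ∧ Algebra.Smooth A (Localization.Away b) := by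
  have := Algebra.FinitePresentation.of_finiteType.mp ‹Algebra.FiniteType A B›
  let K := FractionRing A
  let L := FractionRing B
  have : FaithfulSMul A B := (faithfulSMul_iff_algebraMap_injective A B).mpr hinj
  have : FaithfulSMul A L := .trans A B L
  let : Algebra K L := FractionRing.liftAlgebra A L
  have : IsScalarTower A K L := FractionRing.isScalarTower_liftAlgebra A L
  have : CharZero K := charZero_of_injective_algebraMap (IsFractionRing.injective A K)
  have : Algebra.EssFiniteType B L := .of_isLocalization _ (nonZeroDivisors B)
  have : Algebra.EssFiniteType A L := .comp A B L
  have : Algebra.EssFiniteType K L := .of_comp A K L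
  have : Algebra.FormallySmooth A K := .of_isLocalization (nonZeroDivisors A)
  have : Algebra.FormallySmooth A L := .comp A K L
  have : IsLocalization (⊥ : Ideal B).primeCompl L := by
    rw [Ideal.primeCompl_bot]
    infer_instance
  have : Algebra.IsSmoothAt A (⊥ : Ideal B) :=
    .of_equiv ((IsLocalization.algEquiv (⊥ : Ideal B).primeCompl L
      (Localization.AtPrime (⊥ : Ideal B))).restrictScalars A)
  exact Algebra.IsSmoothAt.exists_notMem_smooth A (⊥ : Ideal B)

/-- A localization of a localization of `S` away from nonzero elements is a localization of `S`
away from a nonzero element. -/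
lemma IsLocalization.Away.exists_isLocalization_of_tower {S T U : Type*} [CommRing S]
    [CommRing T] [CommRing U] [Algebra S T] [Algebra T U] [Algebra S U] [IsScalarTower S T U]
    {s : S} [IsLocalization.Away s T] {t : T} [IsLocalization.Away t U] :
    ∃ a : S, Associated t (algebraMap S T a) ∧ IsLocalization.Away (s * a) U := by
  obtain ⟨n, a, ha⟩ := IsLocalization.Away.surj s t
  have hassoc : Associated t (algebraMap S T a) :=
    ⟨((IsLocalization.Away.algebraMap_isUnit s).pow n).unit, ha⟩
  have := IsLocalization.Away.of_associated (S := U) hassoc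
  exact ⟨a, hassoc, IsLocalization.Away.mul' T U s a⟩

/-- A dominant rational map of affine varieties is regular on a basic open subset. -/
lemma exists_algHom_localizationAway (k R S FS : Type*) [Field k]
    [CommRing R] [Algebra k R] [Algebra.FiniteType k R]
    [CommRing S] [IsDomain S] [Algebra k S] [Field FS] [Algebra S FS] [IsFractionRing S FS]
    [Algebra k FS] [IsScalarTower k S FS] (ψ : R →ₐ[k] FS) :
    ∃ s : S, s ≠ 0 ∧ ∃ (f : R →ₐ[k] Localization.Away s) (ι : Localization.Away s →ₐ[k] FS),
      (ι : Localization.Away s →+* FS).comp (algebraMap S (Localization.Away s)) =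
        algebraMap S FS ∧ ι.comp f = ψ := by
  obtain ⟨G, hG⟩ := ‹Algebra.FiniteType k R›.out
  obtain ⟨⟨s, hs⟩, hsG⟩ :=
    IsLocalization.exist_integer_multiples (nonZeroDivisors S) G fun x ↦ ψ x
  have hs0 : s ≠ 0 := nonZeroDivisors.ne_zero hs
  have hle : Submonoid.powers s ≤ nonZeroDivisors S :=
    powers_le_nonZeroDivisors_of_noZeroDivisors hs0
  let ι₀ : Localization.Away s →ₐ[S] FS :=
    IsLocalization.liftAlgHom (M := Submonoid.powers s) (f := Algebra.ofId S FS)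
      fun y ↦ IsLocalization.map_units FS (⟨y, hle y.2⟩ : nonZeroDivisors S)
  let ι : Localization.Away s →ₐ[k] FS := ι₀.restrictScalars k
  have hι₀ (x : S) : ι (algebraMap S _ x) = algebraMap S FS x := ι₀.commutes x
  have hinj : Function.Injective ι := by
    refine (IsLocalization.lift_injective_iff _).mpr fun x y ↦ ?_
    have h₁ := (IsFractionRing.injective S FS).eq_iff (a := x) (b := y)
    have h₂ := (IsLocalization.injective (Localization.Away s) hle).eq_iff (a := x) (b := y)
    exact h₂.trans h₁.symm
  have hmem (x : R) : ψ x ∈ ι.range := by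
    have hx : ψ x ∈ (⊤ : Subalgebra k R).map ψ := ⟨x, trivial, rfl⟩
    rw [← hG, AlgHom.map_adjoin] at hx
    refine Algebra.adjoin_le ?_ hx
    rintro _ ⟨g, hg, rfl⟩
    obtain ⟨b, hb⟩ := hsG g hg
    refine ⟨IsLocalization.mk' _ b ⟨s, Submonoid.mem_powers s⟩, ?_⟩
    have hs' : algebraMap S FS s ≠ 0 := by simpa using hs0
    refine mul_left_cancel₀ hs' ?_
    change _ * ι _ = _
    rw [← hι₀, ← map_mul, IsLocalization.mk'_spec'_mk, hι₀, hι₀, hb, Algebra.smul_def]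
  refine ⟨s, hs0, (AlgEquiv.ofInjective ι hinj).symm.toAlgHom.comp (ψ.codRestrict ι.range hmem), ι,
    RingHom.ext hι₀, AlgHom.ext fun x ↦ ?_⟩
  exact congrArg Subtype.val
    ((AlgEquiv.ofInjective ι hinj).apply_symm_apply (ψ.codRestrict ι.range hmem x))

/-- **Proposition 6.5.** -/
theorem inverse_image_eq_proper_transform_generically
    (k : Type*) [Field k] [CharZero k]
    -- `k` is a finitely generated field
    (hk : (⊤ : IntermediateField ℚ k).FG)
    (R : Type*) [CommRing R] [IsDomain R] [Algebra k R] [Algebra.FiniteType k R]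
    (S : Type*) [CommRing S] [IsDomain S] [Algebra k S] [Algebra.FiniteType k S]
    (FR : Type*) [Field FR] [Algebra R FR] [IsFractionRing R FR]
    [Algebra k FR] [IsScalarTower k R FR]
    (FS : Type*) [Field FS] [Algebra S FS] [IsFractionRing S FS]
    [Algebra k FS] [IsScalarTower k S FS]
    -- the dominant rational map `φ : Z → X`, as an embedding of function fields
    (Φ : FR →ₐ[k] FS) :
    ∃ (r : R), r ≠ 0 ∧ ∃ (s : S), s ≠ 0 ∧
    ∃ (f : Localization.Away r →+* Localization.Away s)
      (ιR : Localization.Away r →+* FR) (ιS : Localization.Away s →+* FS),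
      -- `ι_R`, `ι_S` are the canonical embeddings of the localisations in the function fields
      ιR.comp (algebraMap R (Localization.Away r)) = algebraMap R FR ∧
      ιS.comp (algebraMap S (Localization.Away s)) = algebraMap S FS ∧
      -- `f` is the restriction `φ^V : V → U` of `φ` ...
      ιS.comp f = (Φ : FR →+* FS).comp ιR ∧
      -- ... which is a dominant regular morphism ...
      Function.Injective f ∧
      -- ... and all but finitely many hypersurfaces on `U` have equal scheme-theoretic
      -- inverse image and proper transform:
      {I : Ideal (Localization.Away r) |
        IsHypersurfaceIdeal I ∧ I.map f ≠ properTransform f I}.Finite := by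
  obtain ⟨s, hs, f₁, ι₁, hι₁, hf₁⟩ := exists_algHom_localizationAway k R S FS
    (Φ.comp (IsScalarTower.toAlgHom k R FR))
  have hf₁' (x : R) : ι₁ (f₁ x) = Φ (algebraMap R FR x) := DFunLike.congr_fun hf₁ x
  have hinj₁ : Function.Injective f₁ := by
    refine Function.Injective.of_comp (f := ι₁) ?_
    rw [← AlgHom.coe_comp, hf₁]
    exact Φ.injective.comp (IsFractionRing.injective R FR)
  have hdom : IsDomain (Localization.Away s) :=
    IsLocalization.isDomain_localization (powers_le_nonZeroDivisors_of_noZeroDivisors hs)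
  let : Algebra R (Localization.Away s) := f₁.toRingHom.toAlgebra
  have : IsScalarTower k R (Localization.Away s) := .of_algebraMap_eq' f₁.comp_algebraMap.symm
  have : Algebra.FiniteType k (Localization.Away s) := .trans (S := S) ‹_› inferInstance
  have : Algebra.FiniteType R (Localization.Away s) :=
    .of_restrictScalars_finiteType k R (Localization.Away s)
  have : IsNoetherianRing R := Algebra.FiniteType.isNoetherianRing k R
  have : CharZero R := charZero_of_injective_algebraMap (algebraMap k R).injective
  obtain ⟨t, ht, hsm⟩ :=
    Algebra.exists_smooth_localizationAway R (Localization.Away s) hinj₁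
  obtain ⟨a, hta, hU⟩ := IsLocalization.Away.exists_isLocalization_of_tower (S := S)
    (T := Localization.Away s) (U := Localization.Away t) (s := s) (t := t)
  have hsa : s * a ≠ 0 := by
    refine mul_ne_zero hs ?_
    rintro rfl
    exact ht (by simpa using hta)
  let e : Localization.Away t ≃ₐ[S] Localization.Away (s * a) :=
    IsLocalization.algEquiv (.powers (s * a)) _ _
  let e₁ : R ≃ₐ[R] Localization.Away (1 : R) := IsLocalization.atOne R _
  let g : R →+* Localization.Away (s * a) :=
    (e : Localization.Away t →+* _).comp (algebraMap R (Localization.Away t))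
  let f : Localization.Away (1 : R) →+* Localization.Away (s * a) :=
    g.comp (e₁.symm : Localization.Away (1 : R) →+* R)
  have hf : f.Smooth :=
    .comp (.of_bijective e₁.symm.bijective)
      (.comp (RingHom.smooth_algebraMap.mpr hsm) (.of_bijective e.bijective))
  let ιR : Localization.Away (1 : R) →+* FR :=
    IsLocalization.Away.lift (1 : R) (g := algebraMap R FR) (by simp)
  let ιS : Localization.Away (s * a) →+* FS :=
    IsLocalization.Away.lift (s * a) (g := algebraMap S FS) (by simpa using hsa)
  have hιR : ιR.comp (algebraMap R _) = algebraMap R FR := IsLocalization.Away.lift_comp _ _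
  have hιS : ιS.comp (algebraMap S _) = algebraMap S FS := IsLocalization.Away.lift_comp _ _
  have hιe : (ιS.comp (e : Localization.Away t →+* _)).comp (algebraMap (Localization.Away s) _) =
      ι₁ := by
    refine IsLocalization.ringHom_ext (.powers s) ?_
    rw [hι₁, RingHom.comp_assoc, ← IsScalarTower.algebraMap_eq, ← hιS]
    ext x
    simp
  have hcomm : ιS.comp f = (Φ : FR →+* FS).comp ιR := by
    refine IsLocalization.ringHom_ext (.powers (1 : R)) ?_
    rw [RingHom.comp_assoc _ ιR, hιR]
    ext x
    have hx : e₁.symm (algebraMap R _ x) = x := e₁.symm.commutes x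
    simp only [f, g, RingHom.comp_apply, RingHom.coe_coe, hx]
    rw [← hf₁', IsScalarTower.algebraMap_apply R (Localization.Away s)]
    exact DFunLike.congr_fun hιe (f₁ x)
  have hιRinj : Function.Injective ιR := by
    refine Function.Injective.of_comp_right (g := e₁) ?_ e₁.surjective
    have : ιR ∘ e₁ = algebraMap R FR := by
      ext x
      exact (congrArg ιR (e₁.commutes x)).trans (DFunLike.congr_fun hιR x)
    rw [this]
    exact IsFractionRing.injective R FR
  refine ⟨1, one_ne_zero, s * a, hsa, f, ιR, ιS, hιR, hιS, hcomm, ?_, ?_⟩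
  · refine Function.Injective.of_comp (f := ιS) ?_
    rw [← RingHom.coe_comp, hcomm]
    exact Φ.injective.comp hιRinj
  · convert Set.finite_empty
    exact Set.eq_empty_of_forall_notMem fun I hI ↦
      hI.2 (hI.1.1.map_eq_properTransform hf)
end
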